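/- arXiv:1608.07656 — 6 statements merged into one kernel-verified Lean document; each statement's English description precedes it below -/
import Mathlib

section
/- Let p be a prime and let R₁, R₂ be complete discrete valuation rings of mixed characteristic (0,p) with perfect residue fields, with maximal ideals 𝔪₁, 𝔪₂. Let n₁, n₂ ≥ 1 be integers and let φ : R₁/𝔪₁^{n₁} →+* R₂/𝔪₂^{n₂} be a ring homomorphism. If a ∈ R₁ is a Teichmüller representative, i.e. for every natural number s there exists b ∈ R₁ with b^(p^s) = a, then there exists c ∈ R₂ which is a Teichmüller representative of R₂ (for every s there exists d ∈ R₂ with d^(p^s) = c) and whose class in R₂/𝔪₂^{n₂} equals φ applied to the class of a in R₁/𝔪₁^{n₁}. -/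
open IsLocalRing

/-- A ring homomorphism between residue rings of complete discrete valuation rings of
mixed characteristic `(0,p)` with perfect residue fields maps classes of Teichmüller
representatives to classes of Teichmüller representatives. -/
theorem teichmuller_maps_to_teichmuller (p : ℕ) [Fact p.Prime]
    (R₁ R₂ : Type) [CommRing R₁] [CommRing R₂] [IsDomain R₁] [IsDomain R₂]
    [IsLocalRing R₁] [IsLocalRing R₂]
    [IsDiscreteValuationRing R₁] [IsDiscreteValuationRing R₂]
    [IsAdicComplete (maximalIdeal R₁) R₁] [IsAdicComplete (maximalIdeal R₂) R₂]
    [CharZero R₁] [CharZero R₂]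
    [CharP (ResidueField R₁) p] [CharP (ResidueField R₂) p]
    [PerfectRing (ResidueField R₁) p] [PerfectRing (ResidueField R₂) p]
    (n₁ n₂ : ℕ) (hn₁ : 1 ≤ n₁) (hn₂ : 1 ≤ n₂)
    (φ : (R₁ ⧸ maximalIdeal R₁ ^ n₁) →+* (R₂ ⧸ maximalIdeal R₂ ^ n₂))
    (a : R₁) (ha : ∀ s : ℕ, ∃ b : R₁, b ^ (p ^ s) = a) :
    ∃ c : R₂, (∀ s : ℕ, ∃ d : R₂, d ^ (p ^ s) = c) ∧
      Ideal.Quotient.mk (maximalIdeal R₂ ^ n₂) c =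
        φ (Ideal.Quotient.mk (maximalIdeal R₁ ^ n₁) a) := by
  classical
  haveI : CharP (R₂ ⧸ maximalIdeal R₂) p := inferInstanceAs (CharP (ResidueField R₂) p)
  choose b hb using ha
  choose y hy using fun s => Ideal.Quotient.mk_surjective
    (φ (Ideal.Quotient.mk (maximalIdeal R₁ ^ n₁) (b s)))
  have hyp : ∀ s, Ideal.Quotient.mk (maximalIdeal R₂ ^ n₂) (y s ^ p ^ s) =
      φ (Ideal.Quotient.mk (maximalIdeal R₁ ^ n₁) a) := by
    intro s
    rw [map_pow, hy, ← map_pow, ← map_pow, hb]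
  have hres : ∀ s t, residue R₂ (y s) ^ p ^ s = residue R₂ (y t) ^ p ^ t := by
    intro s t
    have h := (hyp s).trans (hyp t).symm
    rw [Ideal.Quotient.eq] at h
    have h2 := Ideal.pow_le_self (by omega : n₂ ≠ 0) h
    rw [← map_pow, ← map_pow]
    exact Ideal.Quotient.eq.2 h2
  have hstep : ∀ s, residue R₂ (y (s + 1)) ^ p = residue R₂ (y s) := by
    intro s
    apply (bijective_iterateFrobenius (ResidueField R₂) p s).1
    rw [iterateFrobenius_def, iterateFrobenius_def, ← pow_mul, ← pow_succ']
    exact hres (s + 1) s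
  let x : Perfection (R₂ ⧸ maximalIdeal R₂) p :=
    ⟨fun n => Ideal.Quotient.mk _ (y n), fun n => hstep n⟩
  refine ⟨Perfection.teichmuller p (maximalIdeal R₂) x, fun s => ?_, ?_⟩
  · obtain ⟨z, hz⟩ := (bijective_iterateFrobenius
      (Perfection (R₂ ⧸ maximalIdeal R₂) p) p s).2 x
    refine ⟨Perfection.teichmuller p (maximalIdeal R₂) z, ?_⟩
    rw [← map_pow, ← iterateFrobenius_def, hz]
  · rw [← hyp n₂]
    have h := Perfection.teichmuller_sModEq (p := p) (I := maximalIdeal R₂) (x := x)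
      (y := y n₂) (n := n₂) rfl
    rw [SModEq.sub_mem] at h
    exact Ideal.Quotient.eq.2 (Ideal.pow_le_pow_right (Nat.le_succ _) h)
end

section
/- Let p be a prime and let R be a complete discrete valuation ring of mixed characteristic (0,p) with perfect residue field, with maximal ideal 𝔪 and absolute ramification index e (so Ideal.span {(p : R)} = 𝔪^e). Let c ≥ 0 be the integer with Ideal.span {(e : R)} = 𝔪^c, and let n be an integer with n > e + e·c. Then there exists a group homomorphism L from the group of ring automorphisms of R/𝔪^n to the group of ring automorphisms of R such that for every ring automorphism σ of R, L applied to the automorphism of R/𝔪^n induced by σ (every ring automorphism of R maps 𝔪^n onto 𝔪^n and hence induces an automorphism of R/𝔪^n) equals σ. In particular, L is surjective. -/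
open IsLocalRing Polynomial

/-- Convergence of Cauchy sequences for a principal ideal. -/
theorem aux_prec {A : Type*} [CommRing A] (a : A) [h : IsPrecomplete (Ideal.span {a}) A]
    (f : ℕ → A) (hf : ∀ k, a ^ k ∣ f (k + 1) - f k) : ∃ L, ∀ k, a ^ k ∣ L - f k := by
  have hc : ∀ m n, m ≤ n → a ^ m ∣ f n - f m := by
    intro m n hmn
    induction n, hmn using Nat.le_induction with
    | base => simp
    | succ n hn ih =>
      have := dvd_add ((pow_dvd_pow a hn).trans (hf n)) ih
      simpa using this
  obtain ⟨L, hL⟩ := h.prec' f (by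
    intro m n hmn
    rw [SModEq.comm, SModEq.sub_mem, smul_eq_mul, Ideal.mul_top, Ideal.span_singleton_pow,
      Ideal.mem_span_singleton]
    exact hc m n hmn)
  refine ⟨L, fun k => ?_⟩
  have := (hL k).symm
  rwa [SModEq.sub_mem, smul_eq_mul, Ideal.mul_top, Ideal.span_singleton_pow,
      Ideal.mem_span_singleton] at this

theorem aux_prec_of {A : Type*} [CommRing A] (a : A)
    (H : ∀ (f : ℕ → A) (_ : ∀ m n, m ≤ n → a ^ m ∣ f n - f m), ∃ L, ∀ k, a ^ k ∣ L - f k) :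
    IsPrecomplete (Ideal.span {a}) A := by
  constructor
  intro f hf
  obtain ⟨L, hL⟩ := H f (by
    intro m n hmn
    have := (hf hmn).symm
    rwa [SModEq.sub_mem, smul_eq_mul, Ideal.mul_top, Ideal.span_singleton_pow,
      Ideal.mem_span_singleton] at this)
  refine ⟨L, fun n => ?_⟩
  rw [SModEq.comm, SModEq.sub_mem, smul_eq_mul, Ideal.mul_top, Ideal.span_singleton_pow,
      Ideal.mem_span_singleton]
  exact hL n

/-- If terms `θ (w i) y^i` have valuations in distinct classes, then each is as divisible as
the sum. -/
theorem aux_sep {R W : Type*} [CommRing R] [IsDomain R] [CommRing W] (θ : W →+* R) (y : R)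
    (hy : y ≠ 0) (e : ℕ)
    (hP : ∀ w N, y ^ N ∣ θ w → ¬ e ∣ N → y ^ (N + 1) ∣ θ w) (w : ℕ → W) (N : ℕ)
    (h : y ^ N ∣ ∑ i ∈ Finset.range e, θ (w i) * y ^ i) :
    ∀ i < e, y ^ N ∣ θ (w i) * y ^ i := by
  induction N with
  | zero => simp
  | succ N ih =>
    have ih := ih ((pow_dvd_pow y (Nat.le_succ N)).trans h)
    have key : ∀ i < e, i ≠ N % e → y ^ (N + 1) ∣ θ (w i) * y ^ i := by
      intro i hi hne
      by_cases hN : N < i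
      · exact (pow_dvd_pow y hN).trans (dvd_mul_left _ _)
      · have hN : i ≤ N := not_lt.mp hN
        have h1 := ih i hi
        have h2 : y ^ (N - i) ∣ θ (w i) := by
          rw [← Nat.sub_add_cancel hN, pow_add] at h1
          exact (mul_dvd_mul_iff_right (pow_ne_zero i hy)).mp h1
        have h3 := hP _ _ h2 (by
          intro hd
          apply hne
          have := (Nat.modEq_iff_dvd' hN).mpr hd
          rw [← Nat.mod_eq_of_lt hi]
          exact this)
        have h4 := mul_dvd_mul_right h3 (y ^ i)
        rw [← pow_add] at h4
        rwa [show N - i + 1 + i = N + 1 by omega] at h4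
    intro i hi
    by_cases hne : i = N % e
    · rw [← Finset.add_sum_erase _ _ (Finset.mem_range.mpr hi)] at h
      refine (dvd_add_left ?_).mp h
      apply Finset.dvd_sum
      intro j hj
      rw [Finset.mem_erase, Finset.mem_range] at hj
      exact key j hj.2 (by rw [← hne]; exact hj.1)
    · exact key i hi hne

theorem aux_taylor {R : Type*} [CommRing R] (F : R[X]) (u : R) :
    ∃ G : R[X], ∀ t, F.eval (u + t) = F.eval u + F.derivative.eval u * t + t ^ 2 * G.eval t := by
  refine ⟨(taylor u F).divX.divX, fun t => ?_⟩
  have h1 : F.eval (u + t) = (taylor u F).eval t := by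
    rw [taylor_eval, add_comm]
  have h2 := congrArg (eval t) (divX_mul_X_add (taylor u F))
  have h3 := congrArg (eval t) (divX_mul_X_add (taylor u F).divX)
  simp only [eval_add, eval_mul, eval_X, eval_C, coeff_divX, taylor_coeff_zero, zero_add,
    taylor_coeff_one] at h2 h3
  rw [h1, ← h2, ← h3]
  ring

/-- Strong Hensel lemma. -/
theorem aux_hensel {R : Type*} [CommRing R] (y : R) [IsLocalRing R]
    (hy : ∀ x, y ∣ x → ¬ IsUnit x)
    (hprec : ∀ f : ℕ → R, (∀ k, y ^ k ∣ f (k + 1) - f k) → ∃ L, ∀ k, y ^ k ∣ L - f k)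
    (hhaus : ∀ x : R, (∀ k, y ^ k ∣ x) → x = 0)
    (F : R[X]) (u μ : R) (t : ℕ) (ht : 1 ≤ t) (hμ : y ^ t ∣ μ)
    (hF : F.eval u = F.derivative.eval u ^ 2 * μ) :
    ∃ V, y ^ t ∣ V ∧ F.eval (u + F.derivative.eval u * V) = 0 := by
  obtain ⟨G, hG⟩ := aux_taylor F u
  set δ := F.derivative.eval u with hδ
  let H : R[X] := G.comp (C δ * X)
  let ψ : R → R := fun v => -(μ + v * (v * H.eval v))
  have hyμ : y ∣ μ := (dvd_pow_self y (by omega)).trans hμ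
  have hψ : ∀ a b, y ∣ a → y ∣ b → y * (a - b) ∣ ψ a - ψ b := by
    intro a b ha hb
    obtain ⟨q, hq⟩ := sub_dvd_eval_sub a b (X * H)
    simp only [eval_mul, eval_X] at hq
    have : ψ a - ψ b = -((a - b) * (a * H.eval a)) - b * ((a - b) * q) := by
      rw [← hq]; simp only [ψ]; ring
    rw [this]
    obtain ⟨a', rfl⟩ := ha
    obtain ⟨b', rfl⟩ := hb
    exact ⟨-(a' * H.eval (y * a')) - b' * q, by ring⟩
  have hψy : ∀ a, y ∣ a → y ∣ ψ a := by
    intro a ha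
    exact (dvd_neg).mpr (dvd_add hyμ (ha.mul_right _))
  let f : ℕ → R := fun k => ψ^[k] 0
  have hfs : ∀ k, f (k + 1) = ψ (f k) := fun k => Function.iterate_succ_apply' ψ k 0
  have hfy : ∀ k, y ∣ f k := by
    intro k
    induction k with
    | zero => simp [f]
    | succ k ih => rw [hfs]; exact hψy _ ih
  have hfc : ∀ k, y ^ k ∣ f (k + 1) - f k := by
    intro k
    induction k with
    | zero => simp
    | succ k ih =>
      have h1 := (mul_dvd_mul_left y ih).trans (hψ _ _ (hfy _) (hfy _))
      rw [← hfs, ← hfs, ← pow_succ'] at h1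
      exact h1
  obtain ⟨V, hV⟩ := hprec f hfc
  have hVy : y ∣ V := by
    have := dvd_add (hV 1) (by simpa using hfy 1)
    simpa using this
  have hfix : V = ψ V := by
    rw [← sub_eq_zero]
    apply hhaus
    intro k
    have h1 : V - ψ V = (V - f (k + 1)) - (ψ V - ψ (f k)) := by rw [hfs]; ring
    rw [h1]
    apply dvd_sub
    · exact (pow_dvd_pow y (Nat.le_succ k)).trans (hV _)
    · exact ((hV k).trans (dvd_mul_left _ _)).trans (hψ _ _ hVy (hfy _))
  have hμV : V * (1 + V * H.eval V) = -μ := by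
    have : V = -(μ + V * (V * H.eval V)) := hfix
    linear_combination this
  have hunit : IsUnit (1 + V * H.eval V) := by
    have h1 : ¬ IsUnit (-(V * H.eval V)) := hy _ ((dvd_neg).mpr (hVy.mul_right _))
    have := IsLocalRing.isUnit_or_isUnit_of_add_one
      (a := 1 + V * H.eval V) (b := -(V * H.eval V)) (by ring)
    exact this.resolve_right h1
  refine ⟨V, ?_, ?_⟩
  · have : y ^ t ∣ V * (1 + V * H.eval V) := by rw [hμV]; exact (dvd_neg).mpr hμ
    exact hunit.dvd_mul_right.mp this
  · rw [hG, hF]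
    have hH : H.eval V = G.eval (δ * V) := by simp [H]
    rw [hH] at hμV
    linear_combination δ ^ 2 * hμV

theorem aux_uniq {R : Type*} [CommRing R] [IsDomain R] (F : R[X]) (u v : R)
    (hu : F.eval u = 0) (hv : F.eval v = 0) (hne : v ≠ u) : v - u ∣ F.derivative.eval u := by
  obtain ⟨G, hG⟩ := aux_taylor F u
  have := hG (v - u)
  rw [add_sub_cancel, hu, hv] at this
  have h2 : (v - u) * (F.derivative.eval u + (v - u) * G.eval (v - u)) = 0 := by
    linear_combination -this
  have h3 := (mul_eq_zero.mp h2).resolve_left (sub_ne_zero.mpr hne)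
  exact ⟨-G.eval (v - u), by linear_combination h3⟩

/-- the normalized polynomial and its derivative -/
theorem aux_normal {R W : Type*} [CommRing R] [IsDomain R] [CommRing W] (θ : W →+* R) (y : R)
    (hy : y ≠ 0) (e c : ℕ) (he : 1 ≤ e)
    (hP : ∀ w N, y ^ N ∣ θ w → ¬ e ∣ N → y ^ (N + 1) ∣ θ w) (a : ℕ → W)
    (ha : ∀ i < e, y ^ e ∣ θ (a i)) (hec : ¬ y ^ (c + 1) ∣ (e : R)) :
    ∃ F : R[X], (∀ t, y ^ e * F.eval t =
        (y * t) ^ e - ∑ i ∈ Finset.range e, θ (a i) * (y * t) ^ i) ∧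
      ¬ y ^ (c + 1) ∣ F.derivative.eval 1 := by
  choose! b hb using ha
  refine ⟨X ^ e - ∑ i ∈ Finset.range e, C (b i * y ^ i) * X ^ i, ?_, ?_⟩
  · intro t
    simp only [eval_sub, eval_pow, eval_X, eval_finsetSum, eval_mul, eval_C, mul_sub,
      Finset.mul_sum]
    congr 1
    · ring
    · refine Finset.sum_congr rfl fun i hi => ?_
      rw [hb i (Finset.mem_range.mp hi)]; ring
  · intro hd
    obtain ⟨e', rfl⟩ : ∃ e', e = e' + 1 := ⟨e - 1, by omega⟩
    let w : ℕ → W := fun i => if i = e' then ((e' + 1 : ℕ) : W) else -((i + 1 : ℕ) : W) * a (i + 1)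
    have hsum : y ^ e' * (derivative (X ^ (e' + 1) - ∑ i ∈ Finset.range (e' + 1),
        C (b i * y ^ i) * X ^ i)).eval 1 = ∑ i ∈ Finset.range (e' + 1), θ (w i) * y ^ i := by
      apply mul_left_cancel₀ hy
      rw [Finset.sum_range_succ (fun i => θ (w i) * y ^ i), Finset.sum_range_succ' (fun i => C (b i * y ^ i) * X ^ i)]
      have h1 : ∑ i ∈ Finset.range e', θ (w i) * y ^ i =
          - ∑ i ∈ Finset.range e', ((i + 1 : ℕ) : R) * (y ^ (e' + 1) * b (i + 1)) * y ^ i := by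
        rw [← Finset.sum_neg_distrib]
        refine Finset.sum_congr rfl fun i hi => ?_
        have hi := Finset.mem_range.mp hi
        simp only [w, if_neg hi.ne, map_mul, map_neg, map_natCast]
        rw [hb (i + 1) (by omega)]
        ring
      rw [h1]
      simp only [w, if_pos, derivative_sub, derivative_X_pow, derivative_add,
        derivative_sum, derivative_mul, derivative_C, eval_sub, eval_finsetSum,
        eval_mul, eval_C, eval_pow, eval_X, map_natCast, eval_natCast, zero_mul, pow_zero,
        one_pow, mul_one, zero_add, add_zero]
      rw [mul_add, mul_neg, Finset.mul_sum]
      have h2 : ∑ i ∈ Finset.range e', y * (((i + 1 : ℕ) : R) * (y ^ (e' + 1) * b (i + 1)) * y ^ i)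
        = y ^ (e' + 1) * ∑ i ∈ Finset.range e', b (i + 1) * y ^ (i + 1) * ((i + 1 : ℕ) : R) := by
        rw [Finset.mul_sum]
        refine Finset.sum_congr rfl fun i hi => ?_
        ring
      rw [h2]
      ring
    have h3 : y ^ (e' + (c + 1)) ∣ ∑ i ∈ Finset.range (e' + 1), θ (w i) * y ^ i := by
      rw [← hsum, pow_add]
      exact mul_dvd_mul_left _ hd
    have h4 := aux_sep θ y hy _ hP w _ h3 e' (by omega)
    simp only [w, if_pos, map_natCast] at h4
    rw [pow_add, mul_comm (y ^ e')] at h4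
    exact hec ((mul_dvd_mul_iff_right (pow_ne_zero _ hy)).mp h4)

theorem aux_root {R W : Type*} [CommRing R] [IsDomain R] [IsDiscreteValuationRing R] [CommRing W]
    (θ : W →+* R) (y : R) (hy : Irreducible y)
    (hprec : ∀ f : ℕ → R, (∀ k, y ^ k ∣ f (k + 1) - f k) → ∃ L, ∀ k, y ^ k ∣ L - f k)
    (hhaus : ∀ x : R, (∀ k, y ^ k ∣ x) → x = 0)
    (e c : ℕ) (he : 1 ≤ e)
    (hP : ∀ w N, y ^ N ∣ θ w → ¬ e ∣ N → y ^ (N + 1) ∣ θ w) (a : ℕ → W)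
    (ha : ∀ i < e, y ^ e ∣ θ (a i)) (hec : ¬ y ^ (c + 1) ∣ (e : R)) (h2c : 2 * c ≤ e * c)
    (n : ℕ) (hn : e + e * c < n)
    (hr : y ^ n ∣ y ^ e - ∑ i ∈ Finset.range e, θ (a i) * y ^ i) :
    ∃ z, y ^ (c + 2) ∣ z - y ∧ z ^ e = ∑ i ∈ Finset.range e, θ (a i) * z ^ i := by
  obtain ⟨F, hF, hF'⟩ := aux_normal θ y hy.ne_zero e c he hP a ha hec
  have h1 := hF 1
  rw [mul_one] at h1
  rw [← h1] at hr
  have h2 : y ^ (e * c + 1) ∣ F.eval 1 := by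
    have : y ^ (e + (e * c + 1)) ∣ y ^ e * F.eval 1 := (pow_dvd_pow y (by omega)).trans hr
    rw [pow_add] at this
    exact (mul_dvd_mul_iff_left (pow_ne_zero _ hy.ne_zero)).mp this
  have hδ0 : F.derivative.eval 1 ≠ 0 := by
    intro h; rw [h] at hF'; exact hF' (dvd_zero _)
  obtain ⟨d, u, hd⟩ := IsDiscreteValuationRing.eq_unit_mul_pow_irreducible hδ0 hy
  have hdc : d ≤ c := by
    by_contra hlt
    apply hF'
    rw [hd]
    exact (pow_dvd_pow y (by omega)).trans (dvd_mul_left _ _)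
  obtain ⟨q, hq⟩ := h2
  obtain ⟨V, hV, hV0⟩ := aux_hensel y
    (fun x hx hu => hy.not_isUnit (isUnit_of_dvd_unit hx hu)) hprec hhaus F 1
    (y ^ (e * c + 1 - 2 * d) * (q * ((u⁻¹ : Rˣ) : R) ^ 2)) (e * c + 1 - 2 * d) (by omega)
    (dvd_mul_right _ _) (by
      have h3 : y ^ (e * c + 1) = (y ^ d) ^ 2 * y ^ (e * c + 1 - 2 * d) := by
        rw [← pow_mul, ← pow_add]; congr 1; omega
      have h4 : (u : R) * ((u⁻¹ : Rˣ) : R) = 1 := u.mul_inv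
      rw [hq, hd, h3]
      linear_combination (-(y ^ d) ^ 2 * y ^ (e * c + 1 - 2 * d) * q *
        ((u : R) * ((u⁻¹ : Rˣ) : R) + 1)) * h4)
  refine ⟨y * (1 + F.derivative.eval 1 * V), ?_, ?_⟩
  · have h5 : y * (1 + F.derivative.eval 1 * V) - y = y ^ (d + 1) * V * u := by
      rw [hd]; ring
    rw [h5]
    refine Dvd.dvd.mul_right ?_ _
    refine (pow_dvd_pow y ?_).trans (by
      rw [pow_add y (d + 1) (e * c + 1 - 2 * d)]; exact mul_dvd_mul_left _ hV)
    omega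
  · have := hF (1 + F.derivative.eval 1 * V)
    rw [hV0, mul_zero] at this
    exact (sub_eq_zero.mp this.symm)

theorem aux_root_uniq {R W : Type*} [CommRing R] [IsDomain R] [CommRing W]
    (θ : W →+* R) (y : R) (hy : y ≠ 0) (e c : ℕ) (he : 1 ≤ e)
    (hP : ∀ w N, y ^ N ∣ θ w → ¬ e ∣ N → y ^ (N + 1) ∣ θ w) (a : ℕ → W)
    (ha : ∀ i < e, y ^ e ∣ θ (a i)) (hec : ¬ y ^ (c + 1) ∣ (e : R)) (z : R)
    (hyr : y ^ e = ∑ i ∈ Finset.range e, θ (a i) * y ^ i)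
    (hzr : z ^ e = ∑ i ∈ Finset.range e, θ (a i) * z ^ i)
    (hzy : y ^ (c + 2) ∣ z - y) : z = y := by
  obtain ⟨F, hF, hF'⟩ := aux_normal θ y hy e c he hP a ha hec
  obtain ⟨q, hq⟩ := hzy
  have hz : z = y * (1 + y ^ (c + 1) * q) := by linear_combination hq
  have h1 : F.eval 1 = 0 := by
    have := hF 1
    rw [mul_one, ← hyr, sub_self] at this
    exact (mul_eq_zero.mp this).resolve_left (pow_ne_zero _ hy)
  have h2 : F.eval (1 + y ^ (c + 1) * q) = 0 := by
    have := hF (1 + y ^ (c + 1) * q)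
    rw [← hz, ← hzr, sub_self] at this
    exact (mul_eq_zero.mp this).resolve_left (pow_ne_zero _ hy)
  by_contra hne
  apply hF'
  refine Dvd.dvd.trans ?_ (aux_uniq F 1 _ h1 h2 ?_)
  · exact ⟨q, by ring⟩
  · intro h; rw [h, mul_one] at hz; exact hne hz

section witt
variable {p : ℕ} [Fact p.Prime] {k : Type*} [Field k] [CharP k p] [PerfectRing k p]

theorem aux_val {R : Type*} [CommRing R] [IsDomain R] (θ : WittVector p k →+* R) (y : R)
    (hy : Irreducible y) (e : ℕ) (hp : Associated (p : R) (y ^ e)) (w : WittVector p k) (N : ℕ)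
    (h : y ^ N ∣ θ w) (hN : ¬ e ∣ N) : y ^ (N + 1) ∣ θ w := by
  by_cases hw : w = 0
  · simp [hw]
  obtain ⟨m, b, rfl⟩ := WittVector.exists_eq_pow_p_mul' w hw
  have hb : IsUnit (θ b) := b.isUnit.map θ
  rw [map_mul, map_pow, map_natCast] at h ⊢
  rw [hb.dvd_mul_right] at h ⊢
  have h1 : Associated ((p : R) ^ m) (y ^ (e * m)) := by
    rw [pow_mul]; exact hp.pow_pow
  rw [h1.dvd_iff_dvd_right] at h ⊢
  rw [pow_dvd_pow_iff hy.ne_zero hy.not_isUnit] at h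
  apply pow_dvd_pow
  have : N ≠ e * m := fun h => hN ⟨m, h⟩
  omega

theorem aux_inj {R : Type*} [CommRing R] [IsDomain R] [CharZero R] (θ : WittVector p k →+* R)
    (w : WittVector p k) (h : θ w = 0) : w = 0 := by
  by_contra hw
  obtain ⟨m, b, rfl⟩ := WittVector.exists_eq_pow_p_mul' w hw
  have hb : IsUnit (θ b) := b.isUnit.map θ
  rw [map_mul, map_pow, map_natCast] at h
  rcases mul_eq_zero.mp h with h | h
  · have hp := (Fact.out : p.Prime).ne_zero
    exact pow_ne_zero m (Nat.cast_ne_zero.mpr hp) h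
  · exact hb.ne_zero h

theorem aux_witt_uniq {S : Type*} [CommRing S] (I : Ideal S) (hpI : (p : S) ∈ I) (N : ℕ)
    (hI : I ^ N = ⊥) (φ ψ : WittVector p k →+* S) (h : ∀ w, φ w - ψ w ∈ I) : φ = ψ := by
  apply WittVector.eq_of_apply_teichmuller_eq
  · refine ⟨N, ?_⟩
    have := Ideal.pow_mem_pow hpI N
    rwa [hI, Ideal.mem_bot] at this
  · intro x
    obtain ⟨x', rfl⟩ : ∃ x', x' ^ p ^ N = x :=
      ⟨(iterateFrobeniusEquiv k p N).symm x, by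
        have := (iterateFrobeniusEquiv k p N).apply_symm_apply x
        rwa [coe_iterateFrobeniusEquiv, iterateFrobenius_def] at this⟩
    rw [map_pow, map_pow, map_pow]
    have key : ∀ j, φ (WittVector.teichmuller p x') ^ p ^ j ≡
        ψ (WittVector.teichmuller p x') ^ p ^ j [SMOD I ^ (j + 1)] := by
      intro j
      apply SModEq.pow_pow_add_one hpI
      rw [SModEq.sub_mem]
      exact h _
    have := key N
    rw [SModEq.sub_mem, pow_succ, hI, Ideal.bot_mul, Ideal.mem_bot] at this
    exact sub_eq_zero.mp this

/-- Spanning: every element is a combination of `1, y, ..., y^(e-1)`. -/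
theorem aux_span {R : Type*} [CommRing R] (θ : WittVector p k →+* R) (y : R)
    (hhaus : ∀ x : R, (∀ k, (p : R) ^ k ∣ x) → x = 0)
    (hθ : ∀ x : R, ∃ w, y ∣ x - θ w) (e : ℕ) (hp : (p : R) ∣ y ^ e) (x : R) :
    ∃ w : ℕ → WittVector p k, x = ∑ i ∈ Finset.range e, θ (w i) * y ^ i := by
  have step : ∀ x : R, ∃ (w : ℕ → WittVector p k) (r : R),
      x = ∑ i ∈ Finset.range e, θ (w i) * y ^ i + p * r := by
    have aux : ∀ j : ℕ, ∀ x : R, ∃ (w : ℕ → WittVector p k) (r : R),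
        x = ∑ i ∈ Finset.range j, θ (w i) * y ^ i + y ^ j * r := by
      intro j
      induction j with
      | zero => intro x; exact ⟨0, x, by simp⟩
      | succ j ih =>
        intro x
        obtain ⟨w, r, hr⟩ := ih x
        obtain ⟨w0, s, hs⟩ := hθ r
        refine ⟨fun i => if i = j then w0 else w i, s, ?_⟩
        rw [Finset.sum_range_succ]
        beta_reduce
        rw [if_pos rfl]
        have : ∑ i ∈ Finset.range j, θ (if i = j then w0 else w i) * y ^ i =
            ∑ i ∈ Finset.range j, θ (w i) * y ^ i := by
          refine Finset.sum_congr rfl fun i hi => ?_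
          rw [if_neg (Finset.mem_range.mp hi).ne]
        rw [this, hr]
        linear_combination y ^ j * hs
    intro x
    obtain ⟨w, r, hr⟩ := aux e x
    obtain ⟨q, hq⟩ := hp
    exact ⟨w, q * r, by rw [hr, hq]; ring⟩
  choose A r hAr using step
  let xs : ℕ → R := fun j => r^[j] x
  have hxs : ∀ j, xs (j + 1) = r (xs j) := fun j => Function.iterate_succ_apply' r j x
  let S : ℕ → ℕ → WittVector p k := fun i j =>
    ∑ l ∈ Finset.range j, (p : WittVector p k) ^ l * A (xs l) i
  have hS : ∀ j, x = ∑ i ∈ Finset.range e, θ (S i j) * y ^ i + (p : R) ^ j * xs j := by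
    intro j
    induction j with
    | zero => simp [S, xs]
    | succ j ih =>
      have h1 : ∑ i ∈ Finset.range e, θ (S i (j + 1)) * y ^ i =
          ∑ i ∈ Finset.range e, θ (S i j) * y ^ i +
            (p : R) ^ j * ∑ i ∈ Finset.range e, θ (A (xs j) i) * y ^ i := by
        rw [Finset.mul_sum, ← Finset.sum_add_distrib]
        refine Finset.sum_congr rfl fun i _ => ?_
        simp only [S, Finset.sum_range_succ, map_add, map_mul, map_pow, map_natCast]
        ring
      rw [h1, hxs]
      have h2 := hAr (xs j)
      linear_combination ih + (p : R) ^ j * h2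
  have hL : ∀ i, ∃ L, ∀ j, (p : WittVector p k) ^ j ∣ L - S i j := by
    intro i
    apply aux_prec
    intro j
    simp only [S, Finset.sum_range_succ, add_sub_cancel_left]
    exact dvd_mul_right _ _
  choose w hw using hL
  refine ⟨w, ?_⟩
  rw [← sub_eq_zero]
  apply hhaus
  intro j
  have h3 : x - ∑ i ∈ Finset.range e, θ (w i) * y ^ i =
      (p : R) ^ j * xs j - ∑ i ∈ Finset.range e, θ (w i - S i j) * y ^ i := by
    have : ∑ i ∈ Finset.range e, θ (w i - S i j) * y ^ i =
        ∑ i ∈ Finset.range e, θ (w i) * y ^ i - ∑ i ∈ Finset.range e, θ (S i j) * y ^ i := by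
      rw [← Finset.sum_sub_distrib]
      refine Finset.sum_congr rfl fun i _ => ?_
      rw [map_sub]; ring
    rw [this]
    linear_combination hS j
  rw [h3]
  apply dvd_sub (dvd_mul_right _ _)
  apply Finset.dvd_sum
  intro i _
  apply Dvd.dvd.mul_right
  have := map_dvd θ (hw i j)
  simpa using this

end witt

/-- Extension of a homomorphism to the ring generated by a root. -/
theorem aux_ext {R W : Type*} [CommRing R] [IsDomain R] [CommRing W] [Nontrivial W]
    (θ θ' : W →+* R) (y z : R) (hy : y ≠ 0)
    (hhaus : ∀ x : R, (∀ k, y ^ k ∣ x) → x = 0)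
    (e : ℕ) (hP : ∀ w N, y ^ N ∣ θ w → ¬ e ∣ N → y ^ (N + 1) ∣ θ w)
    (hinj : ∀ w, θ w = 0 → w = 0)
    (hspan : ∀ x, ∃ w : ℕ → W, x = ∑ i ∈ Finset.range e, θ (w i) * y ^ i)
    (a : ℕ → W) (hyr : y ^ e = ∑ i ∈ Finset.range e, θ (a i) * y ^ i)
    (hzr : z ^ e = ∑ i ∈ Finset.range e, θ' (a i) * z ^ i) :
    ∃ σ : R →+* R, (∀ w, σ (θ w) = θ' w) ∧ σ y = z := by
  let Φ : W[X] →+* R := eval₂RingHom θ y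
  let Ψ : W[X] →+* R := eval₂RingHom θ' z
  have hs : Function.Surjective Φ := by
    intro x
    obtain ⟨w, hw⟩ := hspan x
    refine ⟨∑ i ∈ Finset.range e, C (w i) * X ^ i, ?_⟩
    rw [hw]
    simp [Φ]
  let f : W[X] := X ^ e - ∑ i ∈ Finset.range e, C (a i) * X ^ i
  have hdeg : (∑ i ∈ Finset.range e, C (a i) * X ^ i).degree < (e : WithBot ℕ) := by
    rw [← mem_degreeLT]
    refine Submodule.sum_mem _ fun i hi => mem_degreeLT.mpr ?_
    exact (degree_C_mul_X_pow_le _ _).trans_lt (by exact_mod_cast Finset.mem_range.mp hi)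
  have hf : f.Monic := monic_X_pow_sub (n := e) hdeg
  have hfd : f.natDegree = e := by
    apply natDegree_eq_of_degree_eq_some
    simp only [f]
    rw [degree_sub_eq_left_of_degree_lt] <;> rw [degree_X_pow]
    exact hdeg
  have hΦf : Φ f = 0 := by
    simp only [f, Φ, coe_eval₂RingHom, eval₂_sub, eval₂_X_pow, eval₂_finsetSum, eval₂_mul, eval₂_C]
    exact sub_eq_zero.mpr hyr
  have hΨf : Ψ f = 0 := by
    simp only [f, Ψ, coe_eval₂RingHom, eval₂_sub, eval₂_X_pow, eval₂_finsetSum, eval₂_mul, eval₂_C]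
    exact sub_eq_zero.mpr hzr
  have hker : RingHom.ker Φ ≤ RingHom.ker Ψ := by
    intro g hg
    rw [RingHom.mem_ker] at hg ⊢
    have hdiv := modByMonic_add_div g f
    have hr0 : Φ (g %ₘ f) = 0 := by
      have := congrArg Φ hdiv
      rw [map_add, map_mul, hΦf, zero_mul, add_zero, hg] at this
      exact this
    have hr : g %ₘ f = 0 := by
      by_cases he : e = 0
      · have : f = 1 := hf.natDegree_eq_zero.mp (by omega)
        rw [this, modByMonic_one]
      have hlt : (g %ₘ f).natDegree < e := by
        rw [← hfd]
        exact natDegree_modByMonic_lt g hf (by intro h; rw [h, natDegree_one] at hfd; omega)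
      have hsum : Φ (g %ₘ f) = ∑ i ∈ Finset.range e, θ ((g %ₘ f).coeff i) * y ^ i :=
        eval₂_eq_sum_range' θ hlt y
      rw [hr0] at hsum
      ext i
      rw [coeff_zero]
      by_cases hi : i < e
      · apply hinj
        have : θ ((g %ₘ f).coeff i) * y ^ i = 0 := by
          apply hhaus
          intro N
          exact aux_sep θ y hy e hP (fun i => (g %ₘ f).coeff i) N (by
            rw [← hsum]; exact dvd_zero _) i hi
        exact (mul_eq_zero.mp this).resolve_right (pow_ne_zero _ hy)
      · exact coeff_eq_zero_of_natDegree_lt (by omega)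
    rw [← hdiv, hr, zero_add, map_mul, hΨf, zero_mul]
  refine ⟨Φ.liftOfSurjective hs ⟨Ψ, hker⟩, ?_, ?_⟩
  · intro w
    have := Φ.liftOfRightInverse_comp_apply _ (Function.rightInverse_surjInv hs) ⟨Ψ, hker⟩ (C w)
    simpa [Φ, Ψ] using this
  · have := Φ.liftOfRightInverse_comp_apply _ (Function.rightInverse_surjInv hs) ⟨Ψ, hker⟩ X
    simpa [Φ, Ψ] using this

theorem aux_theta (p : ℕ) [Fact p.Prime]
    (R : Type) [CommRing R] [IsDomain R] [IsLocalRing R] [IsDiscreteValuationRing R]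
    [IsAdicComplete (maximalIdeal R) R]
    [CharP (ResidueField R) p] [PerfectRing (ResidueField R) p]
    (e : ℕ) (he : 1 ≤ e) (hp : Ideal.span {(p : R)} = maximalIdeal R ^ e) :
    ∃ θ : WittVector p (ResidueField R) →+* R, ∀ w, residue R (θ w) = w.coeff 0 := by
  have hpm : (p : R) ∈ maximalIdeal R := by
    have : (p : R) ∈ maximalIdeal R ^ e := hp ▸ Ideal.mem_span_singleton_self _
    exact Ideal.pow_le_self (by omega) this
  have : Fact (¬ IsUnit (p : R)) := ⟨(mem_maximalIdeal _).mp hpm⟩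
  obtain ⟨π, hπ⟩ := IsDiscreteValuationRing.exists_irreducible R
  have hmπ := hπ.maximalIdeal_eq
  have h1 : IsPrecomplete (Ideal.span {π}) R := by rw [← hmπ]; infer_instance
  have : IsPrecomplete (Ideal.span {(p : R)}) R := by
    apply aux_prec_of
    intro f hf
    have hpπ : ∀ k, (p : R) ^ k ∣ π ^ (e * k) ∧ π ^ (e * k) ∣ (p : R) ^ k := by
      intro k
      rw [hmπ, Ideal.span_singleton_pow, Ideal.span_singleton_eq_span_singleton] at hp
      rw [pow_mul]
      exact ⟨pow_dvd_pow_of_dvd hp.dvd k, pow_dvd_pow_of_dvd hp.symm.dvd k⟩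
    have hle : ∀ k, k ≤ e * k := fun k => Nat.le_mul_of_pos_left k he
    obtain ⟨L, hL⟩ := aux_prec π f (fun k =>
      ((pow_dvd_pow π (hle k)).trans (hpπ k).2).trans (hf k (k + 1) (by omega)))
    refine ⟨L, fun k => ?_⟩
    have h2 := (hpπ k).1.trans (hL (e * k))
    have h3 := dvd_add h2 (hf k (e * k) (hle k))
    simpa using h3
  have : IsHausdorff (Ideal.span {(p : R)}) R :=
    IsHausdorff.of_isLocalRing _ _ (by
      intro h
      have : (1 : R) ∈ Ideal.span {(p : R)} := h ▸ Submodule.mem_top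
      have h2 := (Ideal.span_singleton_le_iff_mem _).mpr hpm this
      exact (Ideal.ne_top_iff_one _).mp (maximalIdeal.isMaximal R).ne_top h2)
  have : IsAdicComplete (Ideal.span {(p : R)}) R := ⟨⟩
  let red : ModP R p →+* ResidueField R := Ideal.Quotient.lift _ (residue R) (by
    intro a ha
    rw [residue_eq_zero_iff]
    exact (Ideal.span_singleton_le_iff_mem _).mpr hpm ha)
  let F : R →+* ModP R p := (iterateFrobenius (ModP R p) p e).comp (Ideal.Quotient.mk _)
  have hF : ∀ a ∈ maximalIdeal R, F a = 0 := by
    intro a ha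
    simp only [F, RingHom.comp_apply, iterateFrobenius_def]
    rw [← map_pow, Ideal.Quotient.eq_zero_iff_mem, hp]
    have h2 : e ≤ p ^ e := (Nat.lt_pow_self (Fact.out : p.Prime).one_lt).le
    exact Ideal.pow_le_pow_right h2 (Ideal.pow_mem_pow ha _)
  let s0 : ResidueField R →+* ModP R p := Ideal.Quotient.lift (maximalIdeal R) F hF
  let s : ResidueField R →+* ModP R p :=
    s0.comp ((iterateFrobeniusEquiv (ResidueField R) p e).symm : ResidueField R →+* ResidueField R)
  have hs : ∀ x, red (s x) = x := by
    intro x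
    obtain ⟨r, hr⟩ := residue_surjective ((iterateFrobeniusEquiv (ResidueField R) p e).symm x)
    have h2 : s x = F r := by
      simp only [s, RingHom.comp_apply, RingHom.coe_coe]
      rw [← hr]; rfl
    have h3 : red (F r) = residue R r ^ p ^ e := by
      simp only [F, RingHom.comp_apply, iterateFrobenius_def]
      rw [map_pow]; rfl
    rw [h2, h3, hr]
    have := (iterateFrobeniusEquiv (ResidueField R) p e).apply_symm_apply x
    rwa [coe_iterateFrobeniusEquiv, iterateFrobenius_def] at this
  let s' : ResidueField R →+* PreTilt R p := Perfection.lift p (ResidueField R) (ModP R p) s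
  refine ⟨(WittVector.fontaineTheta R p).comp (WittVector.map s'), fun w => ?_⟩
  have h4 : ∀ x, residue R x = red (Ideal.Quotient.mk _ x) := fun x => rfl
  rw [RingHom.comp_apply, h4, WittVector.mk_fontaineTheta, WittVector.map_coeff]
  exact hs _

theorem lift_automorphisms_of_residue_ring (p : ℕ) [Fact p.Prime]
    (R : Type) [CommRing R] [IsDomain R] [IsLocalRing R] [IsDiscreteValuationRing R]
    [IsAdicComplete (maximalIdeal R) R] [CharZero R]
    [CharP (ResidueField R) p] [PerfectRing (ResidueField R) p]
    (e c : ℕ) (he : 1 ≤ e)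
    (hp : Ideal.span {(p : R)} = maximalIdeal R ^ e)
    (hc : Ideal.span {(e : R)} = maximalIdeal R ^ c)
    (n : ℕ) (hn : e + e * c < n) :
    ∃ L : RingAut (R ⧸ maximalIdeal R ^ n) →* RingAut R,
      (∀ (σ : RingAut R) (τ : RingAut (R ⧸ maximalIdeal R ^ n)),
        (∀ x : R, τ (Ideal.Quotient.mk (maximalIdeal R ^ n) x) =
          Ideal.Quotient.mk (maximalIdeal R ^ n) (σ x)) → L τ = σ) ∧
      Function.Surjective L := by
  obtain ⟨θ, hθ⟩ := aux_theta p R e he hp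
  obtain ⟨π, hπ⟩ := IsDiscreteValuationRing.exists_irreducible R
  -- basic facts valid for every uniformizer
  have hmem : ∀ y : R, Irreducible y → ∀ N x, x ∈ maximalIdeal R ^ N ↔ y ^ N ∣ x := by
    intro y hy N x
    rw [hy.maximalIdeal_eq, Ideal.span_singleton_pow, Ideal.mem_span_singleton]
  have hprec : ∀ y : R, Irreducible y → ∀ f : ℕ → R, (∀ k, y ^ k ∣ f (k + 1) - f k) →
      ∃ L, ∀ k, y ^ k ∣ L - f k := by
    intro y hy f hf
    have : IsPrecomplete (Ideal.span {y}) R := by rw [← hy.maximalIdeal_eq]; infer_instance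
    exact aux_prec y f hf
  have hhm : ∀ x : R, (∀ k, x ∈ maximalIdeal R ^ k) → x = 0 := by
    intro x hx
    have := IsHausdorff.haus (I := maximalIdeal R) (M := R) inferInstance x
    apply this
    intro k
    rw [SModEq.zero, smul_eq_mul, Ideal.mul_top]
    exact hx k
  have hhaus : ∀ y : R, Irreducible y → ∀ x : R, (∀ k, y ^ k ∣ x) → x = 0 := by
    intro y hy x hx
    exact hhm x fun k => (hmem y hy k x).mpr (hx k)
  have hass : ∀ y : R, Irreducible y → Associated (p : R) (y ^ e) := by
    intro y hy
    rwa [hy.maximalIdeal_eq, Ideal.span_singleton_pow,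
      Ideal.span_singleton_eq_span_singleton] at hp
  have hec : ∀ y : R, Irreducible y → ¬ y ^ (c + 1) ∣ (e : R) := by
    intro y hy hd
    rw [hy.maximalIdeal_eq, Ideal.span_singleton_pow,
      Ideal.span_singleton_eq_span_singleton] at hc
    have := hd.trans hc.dvd
    rw [pow_dvd_pow_iff hy.ne_zero hy.not_isUnit] at this
    omega
  have hpm : (p : R) ∈ maximalIdeal R := by
    have : (p : R) ∈ maximalIdeal R ^ e := hp ▸ Ideal.mem_span_singleton_self _
    exact Ideal.pow_le_self (by omega) this
  have h2c : 2 * c ≤ e * c := by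
    by_cases h1 : e = 1
    · subst h1
      by_cases hc0 : c = 0
      · simp [hc0]
      · exfalso
        have h1 : (1 : R) ∈ maximalIdeal R ^ c := by
          rw [← hc]; simp
        exact (Ideal.ne_top_iff_one _).mp (maximalIdeal.isMaximal R).ne_top
          (Ideal.pow_le_self hc0 h1)
    · exact Nat.mul_le_mul_right c (by omega)
  have hcn : c + 2 ≤ n := by
    have : c ≤ e * c := Nat.le_mul_of_pos_left c he
    omega
  have hcoef : ∀ w, θ w ∈ maximalIdeal R → (p : WittVector p (ResidueField R)) ∣ w := by
    intro w hw
    rw [← Ideal.mem_span_singleton, WittVector.mem_span_p_iff_coeff_zero_eq_zero, ← hθ]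
    exact (residue_eq_zero_iff _).mpr hw
  have hval : ∀ θ' : WittVector p (ResidueField R) →+* R, ∀ y : R, Irreducible y → ∀ w N,
      y ^ N ∣ θ' w → ¬ e ∣ N → y ^ (N + 1) ∣ θ' w :=
    fun θ' y hy w N h hN => aux_val θ' y hy e (hass y hy) w N h hN
  have hspan : ∀ x : R, ∃ w : ℕ → WittVector p (ResidueField R),
      x = ∑ i ∈ Finset.range e, θ (w i) * π ^ i := by
    apply aux_span θ π
    · intro x hx
      apply hhm
      intro k
      have h1 : (p : R) ^ k ∈ maximalIdeal R ^ k := Ideal.pow_mem_pow hpm k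
      exact Ideal.mem_of_dvd _ (hx k) h1
    · intro x
      obtain ⟨w, hw⟩ := WittVector.constantCoeff_surjective (p := p) (residue R x)
      refine ⟨w, ?_⟩
      have : x - θ w ∈ maximalIdeal R ^ 1 := by
        rw [pow_one, ← residue_eq_zero_iff, map_sub, hθ, sub_eq_zero]
        exact hw.symm
      simpa using (hmem π hπ 1 _).mp this
    · exact (hass π hπ).dvd
  obtain ⟨a, ha⟩ := hspan (π ^ e)
  have hap : ∀ i < e, (p : WittVector p (ResidueField R)) ∣ a i := by
    intro i hi
    apply hcoef
    have h1 := aux_sep θ π hπ.ne_zero e (hval θ π hπ) a e (by rw [← ha]) i hi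
    have h2 : π ^ (1 + i) ∣ θ (a i) * π ^ i := (pow_dvd_pow π (by omega)).trans h1
    rw [pow_add, mul_dvd_mul_iff_right (pow_ne_zero _ hπ.ne_zero)] at h2
    simpa using (hmem π hπ 1 _).mpr h2
  have hap' : ∀ θ' : WittVector p (ResidueField R) →+* R, ∀ y : R, Irreducible y → ∀ i < e,
      y ^ e ∣ θ' (a i) := by
    intro θ' y hy i hi
    have h1 := map_dvd θ' (hap i hi)
    rw [map_natCast] at h1
    exact (hass y hy).symm.dvd.trans h1
  -- ring endomorphisms preserve the filtration
  have hmap : ∀ (ρ : R →+* R) (s : ℕ) (x : R), x ∈ maximalIdeal R ^ s →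
      ρ x ∈ maximalIdeal R ^ s := by
    intro ρ s x hx
    have h1 : maximalIdeal R ≤ (maximalIdeal R).comap ρ := by
      intro t ht
      rw [Ideal.mem_comap]
      have h2 : t ^ e ∈ maximalIdeal R ^ e := Ideal.pow_mem_pow ht e
      rw [← hp, Ideal.mem_span_singleton] at h2
      have h3 := map_dvd ρ h2
      rw [map_natCast, map_pow] at h3
      exact (maximalIdeal.isMaximal R).isPrime.mem_of_pow_mem e (Ideal.mem_of_dvd _ h3 hpm)
    have h2 := Ideal.map_le_iff_le_comap.mpr h1
    have h3 : (maximalIdeal R ^ s).map ρ ≤ maximalIdeal R ^ s := by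
      rw [Ideal.map_pow]; exact Ideal.pow_right_mono h2 s
    exact h3 (Ideal.mem_map_of_mem ρ hx)
  -- Witt vector homs into quotients
  have hwitt : ∀ (N : ℕ) (φ ψ : WittVector p (ResidueField R) →+* R ⧸ maximalIdeal R ^ N),
      (∀ w, φ w - ψ w ∈ (maximalIdeal R).map (Ideal.Quotient.mk (maximalIdeal R ^ N))) →
      φ = ψ := by
    intro N φ ψ h
    refine aux_witt_uniq _ ?_ N ?_ φ ψ h
    · have := Ideal.mem_map_of_mem (Ideal.Quotient.mk (maximalIdeal R ^ N)) hpm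
      rwa [map_natCast] at this
    · rw [← Ideal.map_pow, Ideal.map_quotient_self]
  -- rigidity
  have huniq : ∀ ρ : R →+* R, (∀ x, ρ x - x ∈ maximalIdeal R ^ (c + 2)) → ∀ x, ρ x = x := by
    intro ρ hρ
    have h1 : ∀ w, ρ (θ w) = θ w := by
      intro w
      rw [← sub_eq_zero]
      apply hhm
      intro N
      have h2 := hwitt N ((Ideal.Quotient.mk _).comp (ρ.comp θ)) ((Ideal.Quotient.mk _).comp θ)
        (by
          intro w
          simp only [RingHom.comp_apply]
          rw [← map_sub]
          exact Ideal.mem_map_of_mem _ (Ideal.pow_le_self (by omega) (hρ (θ w))))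
      have h3 := RingHom.congr_fun h2 w
      simp only [RingHom.comp_apply] at h3
      exact Ideal.Quotient.eq.mp h3
    have h2 : ρ π = π := by
      refine aux_root_uniq θ π hπ.ne_zero e c he (hval θ π hπ) a (hap' θ π hπ) (hec π hπ) (ρ π)
        ha ?_ ((hmem π hπ _ _).mp (hρ π))
      have := congrArg ρ ha
      simpa [h1] using this
    intro x
    obtain ⟨w, hw⟩ := hspan x
    rw [hw]
    simp [h1, h2]
  -- existence of lifts
  have hex : ∀ τ : (R ⧸ maximalIdeal R ^ n) →+* (R ⧸ maximalIdeal R ^ n), ∃ σ : R →+* R,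
      ∀ x x', Ideal.Quotient.mk (maximalIdeal R ^ n) x' = τ (Ideal.Quotient.mk _ x) →
        x' - σ x ∈ maximalIdeal R ^ (c + 2) := by
    intro τ
    obtain ⟨y, hyτ⟩ := Ideal.Quotient.mk_surjective (τ (Ideal.Quotient.mk _ π))
    have hred : ∀ x x', Ideal.Quotient.mk (maximalIdeal R ^ n) x' = τ (Ideal.Quotient.mk _ x) →
        x ∈ maximalIdeal R → x' ∈ maximalIdeal R := by
      intro x x' h hx
      have h1 : Ideal.Quotient.mk (maximalIdeal R ^ n) (x' ^ n) = 0 := by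
        rw [map_pow, h, ← map_pow, ← map_pow,
          Ideal.Quotient.eq_zero_iff_mem.mpr (Ideal.pow_mem_pow hx n), map_zero]
      rw [Ideal.Quotient.eq_zero_iff_mem] at h1
      exact (maximalIdeal.isMaximal R).isPrime.mem_of_pow_mem n
        (Ideal.pow_le_self (by omega) h1)
    have hyirr : Irreducible y := by
      have h1 : y ∈ maximalIdeal R ^ 1 := by
        rw [pow_one]
        exact hred π y hyτ (by simpa using (hmem π hπ 1 π).mpr (by simp))
      rw [hmem π hπ, pow_one] at h1
      obtain ⟨q, hq⟩ := h1
      have hqu : IsUnit q := by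
        by_contra hqu
        have h2 : π ^ 1 ∣ q := (hmem π hπ 1 q).mp (by rw [pow_one]; exact (mem_maximalIdeal _).mpr hqu)
        rw [pow_one] at h2
        obtain ⟨q', hq'⟩ := h2
        obtain ⟨u, hu⟩ := (hass π hπ).symm.dvd_dvd.1
        obtain ⟨u, hu⟩ := (hass π hπ).symm
        obtain ⟨u', hu'⟩ := Ideal.Quotient.mk_surjective (τ (Ideal.Quotient.mk _ (u : R)))
        have h3 : (p : R) - y ^ e * u' ∈ maximalIdeal R ^ n := by
          rw [← Ideal.Quotient.eq, map_mul, map_pow, hyτ, hu', ← map_pow, ← map_mul, ← map_pow,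
            ← map_mul, hu, map_natCast, map_natCast]
        rw [hmem π hπ] at h3
        have h4 : π ^ (e + 1) ∣ y ^ e * u' := by
          rw [hq, hq', ← mul_assoc, mul_pow, ← pow_two, ← pow_mul, mul_assoc]
          exact (pow_dvd_pow π (by omega)).trans (dvd_mul_right _ _)
        have h5 := dvd_add ((pow_dvd_pow π (show e + 1 ≤ n by omega)).trans h3) h4
        rw [sub_add_cancel] at h5
        have h6 := h5.trans (hass π hπ).dvd
        rw [pow_dvd_pow_iff hπ.ne_zero hπ.not_isUnit] at h6
        omega
      rw [hq]
      exact (irreducible_mul_isUnit hqu).mpr hπ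
    let τb : ResidueField R →+* ResidueField R :=
      Ideal.Quotient.lift (maximalIdeal R) (((Ideal.Quotient.lift (maximalIdeal R ^ n) (residue R)
        (fun x hx => (residue_eq_zero_iff x).mpr (Ideal.pow_le_self (by omega) hx))).comp τ).comp
          (Ideal.Quotient.mk _)) (by
        intro x hx
        obtain ⟨x', hx'⟩ := Ideal.Quotient.mk_surjective (τ (Ideal.Quotient.mk _ x))
        rw [RingHom.comp_apply, RingHom.comp_apply, ← hx', Ideal.Quotient.lift_mk,
          residue_eq_zero_iff]
        exact hred x x' hx' hx)
    have hτb : ∀ x x', Ideal.Quotient.mk (maximalIdeal R ^ n) x' = τ (Ideal.Quotient.mk _ x) →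
        τb (residue R x) = residue R x' := by
      intro x x' h
      have h1 : τb (residue R x) = Ideal.Quotient.lift (maximalIdeal R ^ n) (residue R)
        (fun x hx => (residue_eq_zero_iff x).mpr (Ideal.pow_le_self (by omega) hx))
          (τ (Ideal.Quotient.mk _ x)) := rfl
      rw [h1, ← h, Ideal.Quotient.lift_mk]
    let θ' : WittVector p (ResidueField R) →+* R := θ.comp (WittVector.map τb)
    have hθ' : ∀ w, Ideal.Quotient.mk (maximalIdeal R ^ n) (θ' w) =
        τ (Ideal.Quotient.mk _ (θ w)) := by
      have h1 := hwitt n ((Ideal.Quotient.mk _).comp θ') (τ.comp ((Ideal.Quotient.mk _).comp θ))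
        (by
          intro w
          obtain ⟨r, hr⟩ := Ideal.Quotient.mk_surjective (τ (Ideal.Quotient.mk _ (θ w)))
          simp only [RingHom.comp_apply]
          rw [← hr, ← map_sub]
          apply Ideal.mem_map_of_mem
          rw [← residue_eq_zero_iff, map_sub, sub_eq_zero, ← hτb _ _ hr, hθ]
          simp only [θ', RingHom.comp_apply]
          rw [hθ, WittVector.map_coeff])
      intro w
      exact RingHom.congr_fun h1 w
    have hcomb : ∀ w : ℕ → WittVector p (ResidueField R),
        Ideal.Quotient.mk (maximalIdeal R ^ n) (∑ i ∈ Finset.range e, θ' (w i) * y ^ i) =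
        τ (Ideal.Quotient.mk _ (∑ i ∈ Finset.range e, θ (w i) * π ^ i)) := by
      intro w
      simp only [map_sum, map_mul, map_pow, hθ', hyτ]
    have hr : y ^ n ∣ y ^ e - ∑ i ∈ Finset.range e, θ' (a i) * y ^ i := by
      rw [← hmem y hyirr, ← Ideal.Quotient.eq, hcomb, ← ha]
      simp only [map_pow, hyτ]
    obtain ⟨z, hzy, hz⟩ := aux_root θ' y hyirr (hprec y hyirr) (hhaus y hyirr) e c he
      (hval θ' y hyirr) a (hap' θ' y hyirr) (hec y hyirr) h2c n hn hr
    obtain ⟨σ, hσθ, hσπ⟩ := aux_ext θ θ' π z hπ.ne_zero (hhaus π hπ) e (hval θ π hπ)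
      (aux_inj θ) hspan a ha hz
    refine ⟨σ, fun x x' hx => ?_⟩
    obtain ⟨w, hw⟩ := hspan x
    rw [hw, ← hcomb] at hx
    have h1 : x' - ∑ i ∈ Finset.range e, θ' (w i) * y ^ i ∈ maximalIdeal R ^ (c + 2) :=
      Ideal.pow_le_pow_right hcn (Ideal.Quotient.eq.mp hx)
    have h2 : σ x = ∑ i ∈ Finset.range e, θ' (w i) * z ^ i := by
      rw [hw]; simp [hσθ, hσπ]
    have h3 : ∑ i ∈ Finset.range e, θ' (w i) * z ^ i - ∑ i ∈ Finset.range e, θ' (w i) * y ^ i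
        ∈ maximalIdeal R ^ (c + 2) := by
      rw [← Finset.sum_sub_distrib]
      refine Ideal.sum_mem _ fun i _ => ?_
      rw [← mul_sub]
      exact Ideal.mul_mem_left _ _ (Ideal.mem_of_dvd _ (sub_dvd_pow_sub_pow z y i)
        ((hmem y hyirr _ _).mpr hzy))
    have h4 := Ideal.sub_mem _ h1 h3
    rw [h2]
    convert h4 using 1
    ring
  -- composition
  have hcomp : ∀ (τ τ' : (R ⧸ maximalIdeal R ^ n) →+* (R ⧸ maximalIdeal R ^ n))
      (σ σ' : R →+* R),
      (∀ x x', Ideal.Quotient.mk (maximalIdeal R ^ n) x' = τ (Ideal.Quotient.mk _ x) →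
        x' - σ x ∈ maximalIdeal R ^ (c + 2)) →
      (∀ x x', Ideal.Quotient.mk (maximalIdeal R ^ n) x' = τ' (Ideal.Quotient.mk _ x) →
        x' - σ' x ∈ maximalIdeal R ^ (c + 2)) →
      (∀ x x', Ideal.Quotient.mk (maximalIdeal R ^ n) x' = τ (τ' (Ideal.Quotient.mk _ x)) →
        x' - σ (σ' x) ∈ maximalIdeal R ^ (c + 2)) := by
    intro τ τ' σ σ' h h' x x' hx
    obtain ⟨x1, hx1⟩ := Ideal.Quotient.mk_surjective (τ' (Ideal.Quotient.mk _ x))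
    rw [← hx1] at hx
    have h1 := h _ _ hx
    have h2 := hmap σ _ _ (h' _ _ hx1)
    have h3 := Ideal.add_mem _ h1 h2
    rw [map_sub] at h3
    convert h3 using 1
    ring
  have hinv : ∀ (τ τ' : (R ⧸ maximalIdeal R ^ n) →+* (R ⧸ maximalIdeal R ^ n))
      (σ σ' : R →+* R),
      (∀ x x', Ideal.Quotient.mk (maximalIdeal R ^ n) x' = τ (Ideal.Quotient.mk _ x) →
        x' - σ x ∈ maximalIdeal R ^ (c + 2)) →
      (∀ x x', Ideal.Quotient.mk (maximalIdeal R ^ n) x' = τ' (Ideal.Quotient.mk _ x) →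
        x' - σ' x ∈ maximalIdeal R ^ (c + 2)) →
      (∀ x, τ (τ' x) = x) → ∀ x, σ (σ' x) = x := by
    intro τ τ' σ σ' h h' hττ x
    refine huniq (σ.comp σ') (fun x => ?_) x
    have h1 := hcomp τ τ' σ σ' h h' x x (hττ _).symm
    rw [← neg_mem_iff, neg_sub]
    exact h1
  have hlift : ∀ τ : RingAut (R ⧸ maximalIdeal R ^ n), ∃ σ : RingAut R,
      ∀ x x', Ideal.Quotient.mk (maximalIdeal R ^ n) x' = τ (Ideal.Quotient.mk _ x) →
        x' - σ x ∈ maximalIdeal R ^ (c + 2) := by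
    intro τ
    obtain ⟨σ, hσ⟩ := hex (τ : (R ⧸ maximalIdeal R ^ n) ≃+* (R ⧸ maximalIdeal R ^ n)).toRingHom
    obtain ⟨σ', hσ'⟩ :=
      hex (RingEquiv.symm (τ : (R ⧸ maximalIdeal R ^ n) ≃+* (R ⧸ maximalIdeal R ^ n))).toRingHom
    refine ⟨RingEquiv.ofRingHom σ σ' ?_ ?_, hσ⟩
    · ext x
      exact hinv _ _ σ σ' hσ hσ' (fun x => RingEquiv.apply_symm_apply τ x) x
    · ext x
      exact hinv _ _ σ' σ hσ' hσ (fun x => RingEquiv.symm_apply_apply τ x) x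
  have hlu : ∀ (τ : RingAut (R ⧸ maximalIdeal R ^ n)) (σ σ' : RingAut R),
      (∀ x x', Ideal.Quotient.mk (maximalIdeal R ^ n) x' = τ (Ideal.Quotient.mk _ x) →
        x' - σ x ∈ maximalIdeal R ^ (c + 2)) →
      (∀ x x', Ideal.Quotient.mk (maximalIdeal R ^ n) x' = τ (Ideal.Quotient.mk _ x) →
        x' - σ' x ∈ maximalIdeal R ^ (c + 2)) → σ = σ' := by
    intro τ σ σ' h h'
    have h1 := huniq ((RingEquiv.symm σ').toRingHom.comp (RingEquiv.toRingHom σ)) (by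
      intro x
      obtain ⟨x1, hx1⟩ := Ideal.Quotient.mk_surjective (τ (Ideal.Quotient.mk _ x))
      have h2 := Ideal.sub_mem _ (h' _ _ hx1) (h _ _ hx1)
      have h3 := hmap (RingEquiv.symm σ').toRingHom _ _ h2
      have h4 : (RingEquiv.symm σ').toRingHom (x1 - σ' x - (x1 - σ x)) =
          (RingEquiv.symm σ').toRingHom (σ x) - x := by
        rw [sub_sub_sub_cancel_left, map_sub]
        congr 1
        exact RingEquiv.symm_apply_apply σ' x
      rw [h4] at h3
      exact h3)
    apply RingEquiv.ext
    intro x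
    have h2 : RingEquiv.symm σ' (σ x) = x := h1 x
    rw [RingEquiv.symm_apply_eq] at h2
    exact h2
  choose L hL using hlift
  have hLσ : ∀ (σ : RingAut R) (τ : RingAut (R ⧸ maximalIdeal R ^ n)),
        (∀ x : R, τ (Ideal.Quotient.mk (maximalIdeal R ^ n) x) =
          Ideal.Quotient.mk (maximalIdeal R ^ n) (σ x)) → L τ = σ := by
    intro σ τ h
    refine hlu τ _ _ (hL τ) fun x x' hx => ?_
    rw [h] at hx
    exact Ideal.pow_le_pow_right hcn (Ideal.Quotient.eq.mp hx)
  refine ⟨MonoidHom.mk' L ?_, hLσ, ?_⟩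
  · intro τ τ'
    refine hlu (τ * τ') _ _ (hL _) ?_
    exact hcomp (RingEquiv.toRingHom τ) (RingEquiv.toRingHom τ') (RingEquiv.toRingHom (L τ))
      (RingEquiv.toRingHom (L τ')) (hL τ) (hL τ')
  · intro σ
    have hσm : maximalIdeal R ^ n = (maximalIdeal R ^ n).map (RingEquiv.toRingHom σ) := by
      apply le_antisymm
      · intro x hx
        have h1 := hmap (RingEquiv.symm σ).toRingHom n x hx
        have h2 := Ideal.mem_map_of_mem (RingEquiv.toRingHom σ) h1
        have h3 : RingEquiv.toRingHom σ ((RingEquiv.symm σ).toRingHom x) = x :=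
          RingEquiv.apply_symm_apply σ x
        rwa [h3] at h2
      · rw [Ideal.map_le_iff_le_comap]
        exact fun x hx => hmap (RingEquiv.toRingHom σ) n x hx
    exact ⟨Ideal.quotientEquiv _ _ σ hσm, hLσ σ _ (fun x => rfl)⟩
end

section
/- Let p be a prime, k a perfect field of characteristic p, and e ≥ 1 an integer. Let R₁ and R₂ be discrete valuation rings with maximal ideals 𝔪₁, 𝔪₂, each equipped with a W(k)-algebra structure whose structure map is an injective local ring homomorphism, each free of rank e as a W(k)-module, and each satisfying Ideal.span {(p : Rᵢ)} = 𝔪ᵢ^e (totally ramified of degree e over W(k)). Then there is a W(k)-algebra isomorphism R₁/𝔪₁^e ≃ R₂/𝔪₂^e. -/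
open IsLocalRing

theorem aux_coeff_dvd (p : ℕ) [Fact p.Prime]
    (k : Type) [Field k] [CharP k p] [PerfectRing k p]
    (e : ℕ) (R : Type) [CommRing R] [IsDomain R] [IsLocalRing R]
    [IsDiscreteValuationRing R] [Algebra (WittVector p k) R]
    (hram : Ideal.span {(p : R)} = maximalIdeal R ^ e)
    (π : R) (hπ : maximalIdeal R = Ideal.span {π}) (hπ0 : π ≠ 0)
    (hπu : ¬ IsUnit π)
    (a : ℕ → WittVector p k)
    (h : (p : R) ∣ ∑ i ∈ Finset.range e, algebraMap (WittVector p k) R (a i) * π ^ i) :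
    ∀ i, i < e → (p : WittVector p k) ∣ a i := by
  have hpe : π ^ e ∣ (p : R) := by
    rw [hπ, Ideal.span_singleton_pow] at hram
    exact Ideal.span_singleton_le_span_singleton.1 hram.le
  intro i
  induction i using Nat.strong_induction_on with
  | _ i ih =>
    intro hi
    by_contra hd
    have hu : IsUnit (a i) := by
      apply WittVector.isUnit_of_coeff_zero_ne_zero
      intro h0
      apply hd
      rw [← Ideal.mem_span_singleton]
      exact (WittVector.mem_span_p_iff_coeff_zero_eq_zero _).2 h0
    have hie : π ^ (i + 1) ∣ (p : R) := (pow_dvd_pow π hi).trans hpe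
    have hsum := hie.trans h
    rw [← Finset.add_sum_erase _ _ (Finset.mem_range.2 hi)] at hsum
    have hrest : π ^ (i + 1) ∣ ∑ j ∈ (Finset.range e).erase i,
        algebraMap (WittVector p k) R (a j) * π ^ j := by
      apply Finset.dvd_sum
      intro j hj
      rw [Finset.mem_erase, Finset.mem_range] at hj
      rcases lt_or_gt_of_ne hj.1 with hlt | hgt
      · obtain ⟨c, hc⟩ := ih j hlt hj.2
        apply Dvd.dvd.mul_right
        rw [hc, map_mul, map_natCast]
        exact hie.mul_right _
      · exact (pow_dvd_pow π hgt).mul_left _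
    have h1 := (dvd_add_left hrest).1 hsum
    have h2 : π ^ (i + 1) ∣ π ^ i :=
      (hu.map (algebraMap (WittVector p k) R)).dvd_mul_left.1 h1
    have := (pow_dvd_pow_iff hπ0 hπu).1 h2
    omega

theorem aux_span_s8 (p : ℕ) [Fact p.Prime]
    (k : Type) [Field k] [CharP k p] [PerfectRing k p]
    (e : ℕ) (he : 1 ≤ e) (R : Type) [CommRing R] [IsDomain R] [IsLocalRing R]
    [IsDiscreteValuationRing R] [Algebra (WittVector p k) R]
    [Module.Free (WittVector p k) R]
    (hrank : Module.finrank (WittVector p k) R = e)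
    (hram : Ideal.span {(p : R)} = maximalIdeal R ^ e)
    (π : R) (hπ : maximalIdeal R = Ideal.span {π}) (hπ0 : π ≠ 0)
    (hπu : ¬ IsUnit π) :
    Submodule.span (WittVector p k) (Set.range fun i : Fin e => π ^ (i : ℕ)) = ⊤ := by
  have : Module.Finite (WittVector p k) R := Module.finite_of_finrank_pos (by omega)
  let b := Module.finBasisOfFinrankEq (WittVector p k) R hrank
  refine ((Module.Basis.is_basis_iff_det b (v := fun i : Fin e => π ^ (i : ℕ))).2 ?_).2
  apply WittVector.isUnit_of_coeff_zero_ne_zero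
  intro h0
  rw [Module.Basis.det_apply] at h0
  have h1 : (((b.toMatrix fun i : Fin e => π ^ (i : ℕ))).map
      (WittVector.constantCoeff : WittVector p k →+* k)).det = 0 := by
    rw [← h0]
    exact (RingHom.map_det (WittVector.constantCoeff : WittVector p k →+* k) _).symm
  obtain ⟨v, hv, hMv⟩ := Matrix.exists_mulVec_eq_zero_iff.2 h1
  apply hv
  let a : ℕ → WittVector p k := fun i =>
    if hi : i < e then WittVector.teichmuller p (v ⟨i, hi⟩) else 0
  have ha : ∀ i : Fin e, WittVector.constantCoeff (a i) = v i := by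
    intro i
    simp [a, WittVector.constantCoeff]
  have hdvd := aux_coeff_dvd p k e R hram π hπ hπ0 hπu a ?_
  · funext i
    rw [← ha i]
    obtain ⟨c, hc⟩ := hdvd i i.2
    rw [hc, map_mul, map_natCast, CharP.cast_eq_zero, zero_mul, Pi.zero_apply]
  · rw [Finset.sum_range]
    set s := ∑ i : Fin e, algebraMap (WittVector p k) R (a i) * π ^ (i : ℕ) with hs
    have hrepr : ∀ j, (p : WittVector p k) ∣ b.repr s j := by
      intro j
      rw [← Ideal.mem_span_singleton]
      refine (WittVector.mem_span_p_iff_coeff_zero_eq_zero _).2 ?_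
      have := congrFun hMv j
      simp only [Matrix.mulVec, dotProduct, Matrix.map_apply, Pi.zero_apply] at this
      change WittVector.constantCoeff (b.repr s j) = 0
      rw [← this, hs]
      simp only [← Algebra.smul_def, map_sum, map_smul, Finsupp.coe_finsetSum,
        Finset.sum_apply, Finsupp.smul_apply, smul_eq_mul, map_mul, ha,
        Module.Basis.toMatrix_apply]
      exact Finset.sum_congr rfl fun _ _ => mul_comm _ _
    rw [← b.sum_repr s]
    apply Finset.dvd_sum
    intro j _
    obtain ⟨c, hc⟩ := hrepr j
    rw [hc, Algebra.smul_def, map_mul, map_natCast, mul_assoc]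
    exact dvd_mul_right _ _

open Polynomial in
theorem aux_iso (p : ℕ) [Fact p.Prime]
    (k : Type) [Field k] [CharP k p] [PerfectRing k p]
    (e : ℕ) (he : 1 ≤ e) (R : Type) [CommRing R] [IsDomain R] [IsLocalRing R]
    [IsDiscreteValuationRing R] [Algebra (WittVector p k) R]
    [Module.Free (WittVector p k) R]
    (hrank : Module.finrank (WittVector p k) R = e)
    (hram : Ideal.span {(p : R)} = maximalIdeal R ^ e) :
    Nonempty (((WittVector p k)[X] ⧸
      (Ideal.span {C (p : WittVector p k), X ^ e} : Ideal (WittVector p k)[X]))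
        ≃ₐ[WittVector p k] (R ⧸ maximalIdeal R ^ e)) := by
  obtain ⟨π, hirr⟩ := IsDiscreteValuationRing.exists_irreducible R
  have hπ : maximalIdeal R = Ideal.span {π} := hirr.maximalIdeal_eq
  have hπ0 := hirr.ne_zero
  have hπu := hirr.not_isUnit
  let φ : (WittVector p k)[X] →ₐ[WittVector p k] (R ⧸ maximalIdeal R ^ e) :=
    (Ideal.Quotient.mkₐ (WittVector p k) (maximalIdeal R ^ e)).comp (aeval π)
  have hφ : ∀ f, φ f = 0 ↔ (p : R) ∣ aeval π f := by
    intro f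
    rw [← Ideal.mem_span_singleton, hram, ← Ideal.Quotient.eq_zero_iff_mem]
    rfl
  have hsurj : Function.Surjective φ := by
    refine (Ideal.Quotient.mkₐ_surjective (WittVector p k) _).comp ?_
    intro r
    have hr : r ∈ Submodule.span (WittVector p k)
        (Set.range fun i : Fin e => π ^ (i : ℕ)) := by
      rw [aux_span_s8 p k e he R hrank hram π hπ hπ0 hπu]; trivial
    have hle : Submodule.span (WittVector p k) (Set.range fun i : Fin e => π ^ (i : ℕ))
        ≤ LinearMap.range (aeval π : (WittVector p k)[X] →ₐ[WittVector p k] R).toLinearMap := by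
      rw [Submodule.span_le]
      rintro _ ⟨i, rfl⟩
      exact ⟨X ^ (i : ℕ), by simp⟩
    exact hle hr
  have hX : (p : R) ∣ π ^ e := by
    rw [hπ, Ideal.span_singleton_pow] at hram
    exact Ideal.span_singleton_le_span_singleton.1 hram.ge
  have hker : RingHom.ker φ = Ideal.span {C (p : WittVector p k), X ^ e} := by
    apply le_antisymm
    · intro f hf
      have hf := (hφ f).1 hf
      have hm : (X ^ e : (WittVector p k)[X]).Monic := monic_X_pow e
      have hdec := modByMonic_add_div f (X ^ e : (WittVector p k)[X])
      set r := f %ₘ (X ^ e : (WittVector p k)[X]) with hr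
      have hdeg : r.degree < e := by
        simpa using degree_modByMonic_lt f hm
      rw [← hdec, map_add, map_mul, map_pow, aeval_X] at hf
      have hf2 := (dvd_add_left (hX.mul_right _)).1 hf
      have hrd : C (p : WittVector p k) ∣ r := by
        rw [C_dvd_iff_dvd_coeff]
        intro i
        rcases lt_or_ge i e with hi | hi
        · refine aux_coeff_dvd p k e R hram π hπ hπ0 hπu r.coeff ?_ i hi
          rw [aeval_eq_sum_range' (n := e)] at hf2
          · simpa [Algebra.smul_def] using hf2
          · by_cases hr0 : r = 0
            · rw [hr0, natDegree_zero]; omega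
            · exact (natDegree_lt_iff_degree_lt hr0).2 hdeg
        · rw [coeff_eq_zero_of_degree_lt (hdeg.trans_le (by exact_mod_cast hi))]
          exact dvd_zero _
      rw [← hdec]
      refine Ideal.add_mem _ ?_ ?_
      · exact Ideal.mem_of_dvd _ hrd (Ideal.subset_span (by simp))
      · exact Ideal.mul_mem_right _ _ (Ideal.subset_span (by simp))
    · rw [Ideal.span_le]
      rintro f (rfl | rfl)
      · exact (hφ _).2 (by simp)
      · exact (hφ _).2 (by simpa using hX)
  exact ⟨(Ideal.quotientEquivAlgOfEq (WittVector p k) hker.symm).trans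
    (Ideal.quotientKerAlgEquivOfSurjective hsurj)⟩

/-- Any two totally ramified extensions of degree `e` of the Witt ring `W(k)` of a
perfect field `k` of characteristic `p` have `W(k)`-algebra isomorphic `e`-th residue
rings. -/
theorem totally_ramified_residue_rings_iso (p : ℕ) [Fact p.Prime]
    (k : Type) [Field k] [CharP k p] [PerfectRing k p]
    (e : ℕ) (he : 1 ≤ e)
    (R₁ R₂ : Type) [CommRing R₁] [CommRing R₂] [IsDomain R₁] [IsDomain R₂]
    [IsLocalRing R₁] [IsLocalRing R₂]
    [IsDiscreteValuationRing R₁] [IsDiscreteValuationRing R₂]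
    [Algebra (WittVector p k) R₁] [Algebra (WittVector p k) R₂]
    (hinj₁ : Function.Injective (algebraMap (WittVector p k) R₁))
    (hinj₂ : Function.Injective (algebraMap (WittVector p k) R₂))
    [IsLocalHom (algebraMap (WittVector p k) R₁)]
    [IsLocalHom (algebraMap (WittVector p k) R₂)]
    [Module.Free (WittVector p k) R₁] [Module.Free (WittVector p k) R₂]
    (hrank₁ : Module.finrank (WittVector p k) R₁ = e)
    (hrank₂ : Module.finrank (WittVector p k) R₂ = e)
    (hram₁ : Ideal.span {(p : R₁)} = maximalIdeal R₁ ^ e)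
    (hram₂ : Ideal.span {(p : R₂)} = maximalIdeal R₂ ^ e) :
    Nonempty ((R₁ ⧸ maximalIdeal R₁ ^ e) ≃ₐ[WittVector p k] (R₂ ⧸ maximalIdeal R₂ ^ e)) := by
  obtain ⟨f₁⟩ := aux_iso p k e he R₁ hrank₁ hram₁
  obtain ⟨f₂⟩ := aux_iso p k e he R₂ hrank₂ hram₂
  exact ⟨f₁.symm.trans f₂⟩
end

section
/- Let p be a prime, k a perfect field of characteristic p, and e ≥ 1 an integer. Let R be a discrete valuation ring with maximal ideal 𝔪, equipped with a W(k)-algebra structure whose structure map is an injective local ring homomorphism, free of rank e as a W(k)-module, and satisfying Ideal.span {(p : R)} = 𝔪^e. Then there is a ring isomorphism R/𝔪^e ≃ k[X]/(X^e), where k[X]/(X^e) denotes the quotient of the polynomial ring Polynomial k by the ideal generated by X^e. -/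
open IsLocalRing

/-- The `e`-th residue ring of a totally ramified extension of degree `e` of the Witt
ring `W(k)` of a perfect field `k` of characteristic `p` is isomorphic to `k[X]/(X^e)`. -/
theorem totally_ramified_residue_ring_eq_kX (p : ℕ) [Fact p.Prime]
    (k : Type) [Field k] [CharP k p] [PerfectRing k p]
    (e : ℕ) (he : 1 ≤ e)
    (R : Type) [CommRing R] [IsDomain R] [IsLocalRing R] [IsDiscreteValuationRing R]
    [Algebra (WittVector p k) R]
    (hinj : Function.Injective (algebraMap (WittVector p k) R))
    [IsLocalHom (algebraMap (WittVector p k) R)]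
    [Module.Free (WittVector p k) R]
    (hrank : Module.finrank (WittVector p k) R = e)
    (hram : Ideal.span {(p : R)} = maximalIdeal R ^ e) :
    Nonempty ((R ⧸ maximalIdeal R ^ e) ≃+*
      (Polynomial k ⧸ Ideal.span {(Polynomial.X : Polynomial k) ^ e})) := by
  classical
  have hfin : Module.Finite (WittVector p k) R := Module.finite_of_finrank_pos (by omega)
  obtain ⟨π, hπ⟩ := IsDiscreteValuationRing.exists_irreducible R
  have hm : maximalIdeal R = Ideal.span {π} := hπ.maximalIdeal_eq
  let q : R →+* R ⧸ maximalIdeal R ^ e := Ideal.Quotient.mk _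
  have hqz : ∀ r, q r = 0 ↔ π ^ e ∣ r := by
    intro r
    rw [Ideal.Quotient.eq_zero_iff_mem, hm, Ideal.span_singleton_pow, Ideal.mem_span_singleton]
  have hqp : q (p : R) = 0 := by
    rw [Ideal.Quotient.eq_zero_iff_mem, ← hram]
    exact Ideal.mem_span_singleton_self _
  have hk : ∀ a ∈ RingHom.ker (WittVector.constantCoeff : WittVector p k →+* k),
      (q.comp (algebraMap (WittVector p k) R)) a = 0 := by
    intro a ha
    rw [WittVector.ker_constantCoeff, Ideal.mem_span_singleton] at ha
    obtain ⟨c, rfl⟩ := ha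
    simp [hqp]
  let f : k →+* R ⧸ maximalIdeal R ^ e :=
    (WittVector.constantCoeff : WittVector p k →+* k).liftOfSurjective
      (WittVector.constantCoeff_surjective p) ⟨_, hk⟩
  have hf : ∀ w : WittVector p k, f (WittVector.constantCoeff w) = q (algebraMap _ R w) := by
    intro w
    exact RingHom.liftOfRightInverse_comp_apply _ _ _ ⟨_, hk⟩ w
  letI : Algebra k (R ⧸ maximalIdeal R ^ e) := f.toAlgebra
  have hsm : ∀ (w : WittVector p k) (r : R),
      q (w • r) = (WittVector.constantCoeff w : k) • q r := by
    intro w r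
    rw [Algebra.smul_def, Algebra.smul_def, map_mul, ← hf]
    rfl
  -- the dimension of the quotient
  let b := Module.finBasis (WittVector p k) R
  have hspan : ⊤ ≤ Submodule.span k (Set.range fun i => q (b i)) := by
    rintro x -
    obtain ⟨r, rfl⟩ := Ideal.Quotient.mk_surjective x
    change q r ∈ _
    rw [← b.sum_repr r, map_sum]
    refine Submodule.sum_mem _ fun i _ => ?_
    rw [hsm]
    exact Submodule.smul_mem _ _ (Submodule.subset_span ⟨i, rfl⟩)
  haveI : Module.Finite k (R ⧸ maximalIdeal R ^ e) :=
    ⟨⟨Finset.univ.image fun i => q (b i), by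
      rw [Finset.coe_image, Finset.coe_univ, Set.image_univ]; exact top_le_iff.1 hspan⟩⟩
  have hdim : Module.finrank k (R ⧸ maximalIdeal R ^ e) ≤ e := by
    have h := finrank_range_le_card (R := k) (fun i => q (b i))
    rw [Set.finrank, top_le_iff.1 hspan, finrank_top, Fintype.card_fin, hrank] at h
    exact h
  -- the map
  let φ : Polynomial k →ₐ[k] R ⧸ maximalIdeal R ^ e := Polynomial.aeval (q π)
  have hφX : φ Polynomial.X = q π := Polynomial.aeval_X _
  have hunit : ∀ u : Polynomial k, u.coeff 0 ≠ 0 → IsUnit (φ u) := by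
    intro u hu
    have hnil : IsNilpotent (q π) := ⟨e, by rw [← map_pow, hqz]⟩
    rw [← Polynomial.divX_mul_X_add u, map_add, map_mul, hφX]
    refine IsNilpotent.isUnit_add_right_of_commute ?_ ?_ (Commute.all _ _)
    · exact (Commute.all _ _).isNilpotent_mul_left hnil
    · have : IsUnit (Polynomial.C (u.coeff 0)) := (isUnit_iff_ne_zero.2 hu).map _
      exact this.map φ
  have hker : ∀ g : Polynomial k, φ g = 0 → Polynomial.X ^ e ∣ g := by
    intro g hg
    by_cases h0 : g = 0
    · simp [h0]
    obtain ⟨u, hu, hXu⟩ := Polynomial.exists_eq_pow_rootMultiplicity_mul_and_not_dvd g h0 0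
    set n := g.rootMultiplicity 0
    rw [Polynomial.C_0, sub_zero] at hu hXu
    rw [Polynomial.X_dvd_iff] at hXu
    rw [hu, map_mul, (hunit u hXu).mul_left_eq_zero, map_pow, hφX, ← map_pow, hqz,
      pow_dvd_pow_iff hπ.ne_zero hπ.not_isUnit] at hg
    rw [hu]
    exact (pow_dvd_pow _ hg).mul_right _
  have hz : ∀ a ∈ Ideal.span {(Polynomial.X : Polynomial k) ^ e}, φ a = 0 := by
    intro a ha
    obtain ⟨c, rfl⟩ := Ideal.mem_span_singleton.1 ha
    rw [map_mul, map_pow, hφX, ← map_pow, (hqz _).2 dvd_rfl, zero_mul]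
  let ψ := Ideal.Quotient.liftₐ (Ideal.span {(Polynomial.X : Polynomial k) ^ e}) φ hz
  have hψ : Function.Injective ψ := by
    rw [injective_iff_map_eq_zero]
    intro a ha
    obtain ⟨g, rfl⟩ := Ideal.Quotient.mk_surjective a
    exact Ideal.Quotient.eq_zero_iff_mem.2 (Ideal.mem_span_singleton.2 (hker g ha))
  have hd : Module.finrank k (Polynomial k ⧸ Ideal.span {(Polynomial.X : Polynomial k) ^ e}) = e := by
    rw [finrank_quotient_span_eq_natDegree, Polynomial.natDegree_X_pow]
  haveI : Module.Finite k (Polynomial k ⧸ Ideal.span {(Polynomial.X : Polynomial k) ^ e}) :=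
    Module.finite_of_finrank_pos (by omega)
  have hle := LinearMap.finrank_le_finrank_of_injective (f := ψ.toLinearMap) hψ
  have hsurj : Function.Surjective ψ.toLinearMap :=
    (LinearMap.injective_iff_surjective_of_finrank_eq_finrank (by omega)).1 hψ
  exact ⟨(RingEquiv.ofBijective ψ ⟨hψ, hsurj⟩).symm⟩
end

section
/- Let p be a prime and e ≥ 1 an integer not divisible by p. Let R₁, R₂ be complete discrete valuation rings of mixed characteristic (0,p) with perfect residue fields, with maximal ideals 𝔪₁, 𝔪₂ and Ideal.span {(p : Rᵢ)} = 𝔪ᵢ^e for i = 1, 2. If there exists a ring isomorphism R₁/𝔪₁^(e+1) ≃ R₂/𝔪₂^(e+1), then there exists a ring isomorphism R₁ ≃ R₂. -/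
open IsLocalRing

namespace TameAux

theorem complete_pow {R : Type*} [CommRing R] (I : Ideal R) [IsAdicComplete I R] (e : ℕ) (he : 1 ≤ e) :
    IsAdicComplete (I ^ e) R := by
  have hle : ∀ n, (I ^ e) ^ n ≤ I ^ n := fun n => by
    rw [← pow_mul]; exact Ideal.pow_le_pow_right (Nat.le_mul_of_pos_left n he)
  have hH : IsHausdorff (I ^ e) R := ⟨fun x hx => by
    apply IsHausdorff.haus (I := I) inferInstance
    intro n
    have := hx n
    rw [SModEq.zero] at this ⊢
    simp only [smul_eq_mul, Ideal.mul_top] at this ⊢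
    exact hle n this⟩
  have hP : IsPrecomplete (I ^ e) R := ⟨fun f hf => by
    obtain ⟨L, hL⟩ := IsPrecomplete.prec (I := I) inferInstance (f := f) (fun {m n} hmn => by
      have := hf hmn
      rw [SModEq.sub_mem] at this ⊢
      simp only [smul_eq_mul, Ideal.mul_top] at this ⊢
      exact hle m this)
    refine ⟨L, fun n => ?_⟩
    have h1 := hf (Nat.le_mul_of_pos_left n he)
    have h2 := hL (e * n)
    refine h1.trans ?_
    rw [SModEq.sub_mem] at h2 ⊢
    simp only [smul_eq_mul, Ideal.mul_top] at h2 ⊢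
    rwa [← pow_mul]⟩
  exact { hH, hP with }

theorem adjust {R : Type*} [CommRing R] [IsDomain R] [IsLocalRing R]
    [IsAdicComplete (maximalIdeal R) R] (p : ℕ) [CharP (ResidueField R) p]
    (e : ℕ) (he : 1 ≤ e) (hpe : ¬ p ∣ e) (π c : R) (hπ0 : π ≠ 0)
    (hπ : maximalIdeal R = Ideal.span {π})
    (hspan : Ideal.span {(p : R)} = maximalIdeal R ^ e)
    (hc : π ^ e - c * p ∈ maximalIdeal R ^ (e + 1)) :
    ∃ ϖ : R, maximalIdeal R = Ideal.span {ϖ} ∧ ϖ ^ e = c * p := by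
  have hp : (p : R) ∈ maximalIdeal R ^ e := hspan ▸ Ideal.mem_span_singleton_self _
  rw [hπ, Ideal.span_singleton_pow, Ideal.mem_span_singleton] at hp hc
  obtain ⟨u, hu⟩ := hp
  obtain ⟨t, ht⟩ := hc
  have h1 : 1 - c * u = π * t := by
    apply mul_left_cancel₀ (pow_ne_zero e hπ0)
    rw [hu] at ht
    linear_combination ht
  have hmem : 1 - c * u ∈ maximalIdeal R := by
    rw [h1, hπ]; exact Ideal.mul_mem_right _ _ (Ideal.mem_span_singleton_self _)
  have hH := (IsAdicComplete.henselianRing R (maximalIdeal R)).is_henselian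
    (Polynomial.X ^ e - Polynomial.C (c * u)) (Polynomial.monic_X_pow_sub_C _ (by omega)) 1
    (by simpa using hmem) (by
      simp only [Polynomial.derivative_sub, Polynomial.derivative_X_pow, Polynomial.derivative_C]
      simp only [sub_zero, Polynomial.eval_mul, Polynomial.eval_pow, Polynomial.eval_X, one_pow, mul_one,
        Polynomial.eval_natCast, map_natCast]
      have : ((e : ℕ) : ResidueField R) ≠ 0 := by
        rwa [Ne, CharP.cast_eq_zero_iff (ResidueField R) p]
      have h2 : IsUnit ((e : ℕ) : ResidueField R) := isUnit_iff_ne_zero.mpr this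
      exact h2)
  obtain ⟨w, hw, hw1⟩ := hH
  have hwe : w ^ e = c * u := by
    simpa [Polynomial.IsRoot, sub_eq_zero] using hw
  have hwu : IsUnit w := by
    by_contra hn
    have : w ∈ maximalIdeal R := hn
    have h3 := Ideal.sub_mem _ this hw1
    simp at h3
  refine ⟨π * w, ?_, ?_⟩
  · rw [hπ, Ideal.span_singleton_mul_right_unit hwu]
  · rw [mul_pow, hwe, hu]; ring

theorem exists_theta (p : ℕ) [Fact p.Prime] (e : ℕ) (he : 1 ≤ e)
    (R : Type) [CommRing R] [IsLocalRing R]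
    [IsAdicComplete (maximalIdeal R) R]
    [CharP (ResidueField R) p] [PerfectRing (ResidueField R) p]
    (hspan : Ideal.span {(p : R)} = maximalIdeal R ^ e) :
    ∃ θ : WittVector p (ResidueField R) →+* R, ∀ x, residue R (θ x) = x.coeff 0 := by
  have hcomp : IsAdicComplete (Ideal.span {(p : R)}) R := by
    rw [hspan]; exact complete_pow _ e he
  have hpm : (p : R) ∈ maximalIdeal R := by
    have : (p : R) ∈ maximalIdeal R ^ e := hspan ▸ Ideal.mem_span_singleton_self _
    exact Ideal.pow_le_self (by omega) this
  have : Fact (¬ IsUnit (p : R)) := ⟨hpm⟩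
  have hle : Ideal.span {(p : R)} ≤ maximalIdeal R := by
    rwa [Ideal.span_singleton_le_iff_mem]
  let g : ModP R p →+* ResidueField R := Ideal.Quotient.factor hle
  have hg : ∀ x, g (Ideal.Quotient.mk _ x) = residue R x := fun x => rfl
  have hgsurj : Function.Surjective g := fun y => by
    obtain ⟨x, rfl⟩ := residue_surjective y
    exact ⟨_, hg x⟩
  have hpp : 1 < p := (Fact.out : p.Prime).one_lt
  have hnil : ∀ x, g x = 0 → x ^ p ^ e = 0 := by
    intro x hx
    obtain ⟨x, rfl⟩ := Ideal.Quotient.mk_surjective x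
    rw [hg, residue_eq_zero_iff] at hx
    rw [← map_pow, Ideal.Quotient.eq_zero_iff_mem, hspan]
    exact Ideal.pow_le_pow_right (Nat.lt_pow_self hpp).le (Ideal.pow_mem_pow hx _)
  have hcong : ∀ x y, g x = g y → x ^ p ^ e = y ^ p ^ e := by
    intro x y hxy
    have := hnil (x - y) (by rw [map_sub, hxy, sub_self])
    rw [sub_pow_char_pow] at this
    exact sub_eq_zero.mp this
  let q : PreTilt R p →+* ResidueField R := g.comp (PreTilt.coeff 0)
  have hpow : ∀ (x : PreTilt R p) (n m : ℕ), PreTilt.coeff (n + m) x ^ p ^ m = PreTilt.coeff n x := by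
    intro x n m
    induction m with
    | zero => simp
    | succ m ih => rw [pow_succ', pow_mul, ← add_assoc, PreTilt.coeff_pow_p, ih]
  have hq : Function.Bijective q := by
    constructor
    · rw [injective_iff_map_eq_zero]
      intro x hx
      apply Perfection.ext
      intro n
      change PreTilt.coeff n x = 0
      rw [← hpow x n e]
      apply hnil
      have h1 := hpow x 0 (n + e)
      have h2 : g (PreTilt.coeff 0 x) = 0 := hx
      rw [← h1, zero_add, map_pow] at h2
      exact (pow_eq_zero_iff (pow_pos (by omega) _).ne').mp h2
    · intro c
      choose s hs using hgsurj
      let r : ℕ → ResidueField R := fun n => (frobeniusEquiv (ResidueField R) p).symm^[n] c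
      have hr : ∀ n, r (n + 1) ^ p = r n := fun n => by
        simp only [r, Function.iterate_succ_apply', frobeniusEquiv_symm_pow_p]
      have hr' : ∀ n m, r (n + m) ^ p ^ m = r n := by
        intro n m
        induction m with
        | zero => simp
        | succ m ih => rw [pow_succ', pow_mul, ← add_assoc, hr, ih]
      let x : PreTilt R p := ⟨fun n => s (r (n + e)) ^ p ^ e, fun n => by
        change (s (r (n + 1 + e)) ^ p ^ e) ^ p = s (r (n + e)) ^ p ^ e
        rw [← pow_mul, mul_comm, pow_mul]
        apply hcong
        rw [map_pow, hs, hs, ← hr (n + e)]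
        congr 2; omega⟩
      refine ⟨x, ?_⟩
      change g (s (r (0 + e)) ^ p ^ e) = c
      rw [map_pow, hs, hr']
      rfl
  let Q := RingEquiv.ofBijective q hq
  refine ⟨(WittVector.fontaineTheta R p).comp (WittVector.map (Q.symm : ResidueField R →+* PreTilt R p)), fun x => ?_⟩
  rw [← hg, RingHom.comp_apply, WittVector.mk_fontaineTheta, WittVector.map_coeff]
  exact Q.apply_symm_apply _

section main
variable {p : ℕ} [Fact p.Prime] {e : ℕ} {k R : Type*} [Field k] [CharP k p] [PerfectRing k p]
    [CommRing R] [IsDomain R] [IsLocalRing R] [CharZero R]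
    [IsAdicComplete (maximalIdeal R) R]

theorem surj_mod (θ : WittVector p k →+* R)
    (hs : ∀ r, ∃ a, r - θ a ∈ maximalIdeal R) (π : R) 
    (hπ : maximalIdeal R = Ideal.span {π}) (n : ℕ) (r : R) :
    ∃ (d : ℕ → WittVector p k) (t : R), r = ∑ i ∈ Finset.range n, θ (d i) * π ^ i + π ^ n * t := by
  induction n with
  | zero => exact ⟨fun _ => 0, r, by simp⟩
  | succ n ih =>
    obtain ⟨d, t, h⟩ := ih
    obtain ⟨a, ha⟩ := hs t
    rw [hπ, Ideal.mem_span_singleton] at ha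
    obtain ⟨t', ht'⟩ := ha
    refine ⟨Function.update d n a, t', ?_⟩
    rw [Finset.sum_range_succ, Function.update_self, Finset.sum_congr rfl (g := fun i => θ (d i) * π ^ i)]
    · rw [h]; linear_combination π ^ n * ht'
    · intro i hi
      rw [Function.update_of_ne (Finset.mem_range.mp hi).ne]

theorem surj (he : 1 ≤ e) (θ : WittVector p k →+* R)
    (hspan : Ideal.span {(p : R)} = maximalIdeal R ^ e)
    (hs : ∀ r, ∃ a, r - θ a ∈ maximalIdeal R) (π : R) (b : WittVector p k)
    (hπ : maximalIdeal R = Ideal.span {π}) (hb : π ^ e = θ b * p)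
    (r : R) : ∃ f : Polynomial (WittVector p k), f.eval₂ θ π = r := by
  have step : ∀ r, ∃ (d : ℕ → WittVector p k) (t : R),
      r = ∑ i ∈ Finset.range e, θ (d i) * π ^ i + p * t := fun r => by
    obtain ⟨d, t, h⟩ := surj_mod θ hs π hπ e r
    exact ⟨d, θ b * t, by rw [h, hb]; ring⟩
  choose d t hdt using step
  let rr : ℕ → R := fun n => t^[n] r
  have hrr : ∀ n, rr n = ∑ i ∈ Finset.range e, θ (d (rr n) i) * π ^ i + p * rr (n + 1) := fun n => by
    simp only [rr, Function.iterate_succ_apply']; exact hdt _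
  let s : ℕ → ℕ → WittVector p k := fun i n => ∑ j ∈ Finset.range n, (p : WittVector p k) ^ j * d (rr j) i
  have hlim : ∀ i, ∃ L, ∀ n, (p : WittVector p k) ^ n ∣ s i n - L := by
    intro i
    obtain ⟨L, hL⟩ := IsPrecomplete.prec (I := Ideal.span {(p : WittVector p k)}) inferInstance
      (f := s i) (fun {m n} hmn => by
        rw [SModEq.sub_mem]
        simp only [smul_eq_mul, Ideal.mul_top, Ideal.span_singleton_pow, Ideal.mem_span_singleton]
        simp only [s]
        rw [dvd_sub_comm, ← Finset.sum_range_add_sum_Ico _ hmn, add_sub_cancel_left]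
        exact Finset.dvd_sum fun j hj => (pow_dvd_pow _ (Finset.mem_Ico.mp hj).1).mul_right _)
    refine ⟨L, fun n => ?_⟩
    have := hL n
    rw [SModEq.sub_mem] at this
    simpa only [smul_eq_mul, Ideal.mul_top, Ideal.span_singleton_pow, Ideal.mem_span_singleton] using this
  choose L hL using hlim
  have hpart : ∀ n, r = ∑ i ∈ Finset.range e, θ (s i n) * π ^ i + p ^ n * rr n := by
    intro n
    induction n with
    | zero => simp [s, rr]
    | succ n ih =>
      rw [ih, hrr n]
      simp only [s, Finset.sum_range_succ, map_add, map_mul, map_pow, map_natCast, add_mul,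
        Finset.sum_add_distrib, mul_add, Finset.mul_sum, pow_succ, mul_assoc, add_assoc]
  refine ⟨∑ i ∈ Finset.range e, Polynomial.C (L i) * Polynomial.X ^ i, ?_⟩
  simp only [Polynomial.eval₂_finsetSum, Polynomial.eval₂_mul, Polynomial.eval₂_C, Polynomial.eval₂_X_pow]
  rw [← sub_eq_zero]
  have hpm : (p : R) ∈ maximalIdeal R :=
    Ideal.pow_le_self (by omega) (hspan ▸ Ideal.mem_span_singleton_self (p : R))
  apply IsHausdorff.haus (I := maximalIdeal R) inferInstance
  intro n
  rw [SModEq.zero]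
  simp only [smul_eq_mul, Ideal.mul_top]
  refine (Ideal.span_singleton_le_iff_mem (I := maximalIdeal R ^ n)).mpr
    (Ideal.pow_mem_pow hpm n) (Ideal.mem_span_singleton.mpr ?_)
  have h1 : ∑ i ∈ Finset.range e, θ (L i) * π ^ i - r =
      -(∑ i ∈ Finset.range e, θ (s i n - L i) * π ^ i) - p ^ n * rr n := by
    conv_lhs => rw [hpart n]
    simp only [map_sub, sub_mul, Finset.sum_sub_distrib]
    ring
  rw [h1]
  refine dvd_sub (dvd_neg.mpr (Finset.dvd_sum fun i _ => ?_)) (dvd_mul_right _ _)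
  refine Dvd.dvd.mul_right ?_ _
  simpa using map_dvd θ (hL i n)

theorem inj_mod (θ : WittVector p k →+* R) (hspan : Ideal.span {(p : R)} = maximalIdeal R ^ e)
    (hi : ∀ a, θ a ∈ maximalIdeal R → a.coeff 0 = 0) (π : R) (hπ0 : π ≠ 0)
    (hπ : maximalIdeal R = Ideal.span {π}) (n : ℕ) (hn : n ≤ e) (c : ℕ → WittVector p k)
    (h : π ^ n ∣ ∑ i ∈ Finset.range n, θ (c i) * π ^ i) (i : ℕ) (hin : i < n) :
    (p : WittVector p k) ∣ c i := by
  induction n generalizing c i with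
  | zero => omega
  | succ n ih =>
    rw [Finset.sum_range_succ'] at h
    have h0 : (p : WittVector p k) ∣ c 0 := by
      rw [← Ideal.mem_span_singleton, WittVector.mem_span_p_iff_coeff_zero_eq_zero]
      apply hi
      rw [hπ, Ideal.mem_span_singleton]
      have h1 := (dvd_pow_self π n.succ_ne_zero).trans h
      rw [pow_zero, mul_one] at h1
      refine (dvd_add_right (Finset.dvd_sum fun j _ => ?_)).mp h1
      exact (dvd_pow_self π j.succ_ne_zero).mul_left _
    have hp : π ^ (n + 1) ∣ (p : R) := by
      refine (pow_dvd_pow π hn).trans ?_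
      rw [← Ideal.mem_span_singleton, ← Ideal.span_singleton_pow, ← hπ, ← hspan]
      exact Ideal.mem_span_singleton_self _
    have h2 : π ^ (n + 1) ∣ θ (c 0) * π ^ 0 := by
      refine (hp.trans ?_).mul_right _
      simpa using map_dvd θ h0
    have h3 := (dvd_add_left h2).mp h
    simp only [pow_succ, ← mul_assoc, ← Finset.sum_mul] at h3
    have h4 := (mul_dvd_mul_iff_right hπ0).mp h3
    cases i with
    | zero => exact h0
    | succ i => exact ih (by omega) (fun i => c (i + 1)) h4 i (by omega)

theorem inj (θ : WittVector p k →+* R) (hspan : Ideal.span {(p : R)} = maximalIdeal R ^ e)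
    (hi : ∀ a, θ a ∈ maximalIdeal R → a.coeff 0 = 0) (π : R) (hπ0 : π ≠ 0)
    (hπ : maximalIdeal R = Ideal.span {π}) (c : ℕ → WittVector p k)
    (h : ∑ i ∈ Finset.range e, θ (c i) * π ^ i = 0) (i : ℕ) (hin : i < e) : c i = 0 := by
  have key : ∀ N (c : ℕ → WittVector p k), ∑ i ∈ Finset.range e, θ (c i) * π ^ i = 0 →
      ∀ i < e, (p : WittVector p k) ^ N ∣ c i := by
    intro N
    induction N with
    | zero => simp
    | succ N ih =>
      intro c hc i hie
      have h1 := inj_mod θ hspan hi π hπ0 hπ e le_rfl c (by rw [hc]; exact dvd_zero _)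
      have h2 : ∀ i, ∃ y, i < e → c i = p * y := fun i => by
        by_cases hie : i < e
        · obtain ⟨y, hy⟩ := h1 i hie
          exact ⟨y, fun _ => hy⟩
        · exact ⟨0, fun h => absurd h hie⟩
      choose y hy using h2
      have h3 : (p : R) * ∑ i ∈ Finset.range e, θ (y i) * π ^ i = 0 := by
        rw [← hc, Finset.mul_sum]
        refine Finset.sum_congr rfl fun i hi => ?_
        rw [hy i (Finset.mem_range.mp hi)]; simp [mul_assoc]
      have hp0 : (p : R) ≠ 0 := Nat.cast_ne_zero.mpr (Fact.out : p.Prime).ne_zero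
      have h4 := (mul_eq_zero.mp h3).resolve_left hp0
      rw [hy i hie, pow_succ']
      exact mul_dvd_mul_left _ (ih y h4 i hie)
  apply IsHausdorff.haus (I := Ideal.span {(p : WittVector p k)}) inferInstance
  intro n
  rw [SModEq.zero]
  simpa only [smul_eq_mul, Ideal.mul_top, Ideal.span_singleton_pow, Ideal.mem_span_singleton] using
    key n c h i hin

theorem ker_iff (he : 1 ≤ e) (θ : WittVector p k →+* R) (hspan : Ideal.span {(p : R)} = maximalIdeal R ^ e)
    (hi : ∀ a, θ a ∈ maximalIdeal R → a.coeff 0 = 0) (π : R) (hπ0 : π ≠ 0)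
    (hπ : maximalIdeal R = Ideal.span {π}) (b : WittVector p k) (hb : π ^ e = θ b * p)
    (f : Polynomial (WittVector p k)) :
    f.eval₂ θ π = 0 ↔ (Polynomial.X ^ e - Polynomial.C (b * p)) ∣ f := by
  have hm : (Polynomial.X ^ e - Polynomial.C (b * p) : Polynomial (WittVector p k)).Monic :=
    Polynomial.monic_X_pow_sub_C _ (by omega)
  have hg : (Polynomial.X ^ e - Polynomial.C (b * p) : Polynomial (WittVector p k)).eval₂ θ π = 0 := by
    simp [hb]
  constructor
  · intro hf
    rw [← Polynomial.modByMonic_eq_zero_iff_dvd hm]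
    set r := f %ₘ (Polynomial.X ^ e - Polynomial.C (b * p)) with hr
    have hdeg : r.natDegree < e := by
      have := Polynomial.natDegree_modByMonic_lt f hm (by
        intro h1
        have := congrArg Polynomial.natDegree h1
        rw [Polynomial.natDegree_X_pow_sub_C] at this
        simp at this; omega)
      rwa [Polynomial.natDegree_X_pow_sub_C] at this
    have hr0 : r.eval₂ θ π = 0 := by
      have := congrArg (Polynomial.eval₂ θ π) (Polynomial.modByMonic_add_div f (Polynomial.X ^ e - Polynomial.C (b * p)))
      rw [Polynomial.eval₂_add, Polynomial.eval₂_mul, hg, zero_mul, add_zero, hf] at this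
      exact this
    rw [Polynomial.eval₂_eq_sum_range' θ hdeg] at hr0
    have := inj θ hspan hi π hπ0 hπ r.coeff hr0
    ext1 i
    by_cases hie : i < e
    · simpa using this i hie
    · rw [Polynomial.coeff_eq_zero_of_natDegree_lt (by omega)]; simp
  · rintro ⟨q, rfl⟩
    rw [Polynomial.eval₂_mul, hg, zero_mul]

end main

theorem residue_equiv (n : ℕ) (R₁ R₂ : Type) [CommRing R₁] [CommRing R₂] [IsLocalRing R₁] [IsLocalRing R₂]
    (φ : (R₁ ⧸ maximalIdeal R₁ ^ (n + 1)) ≃+* (R₂ ⧸ maximalIdeal R₂ ^ (n + 1))) :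
    ∃ ψ : ResidueField R₁ ≃+* ResidueField R₂, ∀ x y, φ (Ideal.Quotient.mk _ x) = Ideal.Quotient.mk _ y →
      ψ (residue R₁ x) = residue R₂ y := by
  have hle : maximalIdeal R₂ ^ (n + 1) ≤ maximalIdeal R₂ := Ideal.pow_le_self (by omega)
  let g : R₂ ⧸ maximalIdeal R₂ ^ (n + 1) →+* ResidueField R₂ := Ideal.Quotient.factor hle
  have hg : ∀ x, g (Ideal.Quotient.mk _ x) = residue R₂ x := fun x => rfl
  let f : R₁ →+* ResidueField R₂ := (g.comp φ.toRingHom).comp (Ideal.Quotient.mk _)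
  have hfs : Function.Surjective f := fun y => by
    obtain ⟨y, rfl⟩ := residue_surjective y
    obtain ⟨x, hx⟩ := Ideal.Quotient.mk_surjective (φ.symm (Ideal.Quotient.mk _ y))
    refine ⟨x, ?_⟩
    change g (φ (Ideal.Quotient.mk _ x)) = _
    rw [hx, φ.apply_symm_apply, hg]
  have hker : RingHom.ker f = maximalIdeal R₁ :=
    IsLocalRing.eq_maximalIdeal (RingHom.ker_isMaximal_of_surjective f hfs)
  let q : ResidueField R₁ →+* ResidueField R₂ := Ideal.Quotient.lift (maximalIdeal R₁) f
    (fun a ha => by rwa [← hker] at ha)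
  have hq : ∀ x, q (residue R₁ x) = f x := fun x => rfl
  refine ⟨RingEquiv.ofBijective q ⟨q.injective, fun y => ?_⟩, fun x y hxy => ?_⟩
  · obtain ⟨x, rfl⟩ := hfs y
    exact ⟨_, hq x⟩
  · change q (residue R₁ x) = _
    rw [hq]
    change g (φ (Ideal.Quotient.mk _ x)) = _
    rw [hxy, hg]

end TameAux

open TameAux in
/-- In the tamely ramified case (`p ∤ e`), an isomorphism of the `(e+1)`-th residue
rings of two complete discrete valuation rings of mixed characteristic `(0,p)` with
perfect residue fields and absolute ramification index `e` yields an isomorphism of the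
rings themselves. -/
theorem tame_residue_ring_iso_imp_iso (p : ℕ) [Fact p.Prime]
    (e : ℕ) (he : 1 ≤ e) (hpe : ¬ p ∣ e)
    (R₁ R₂ : Type) [CommRing R₁] [CommRing R₂] [IsDomain R₁] [IsDomain R₂]
    [IsLocalRing R₁] [IsLocalRing R₂]
    [IsDiscreteValuationRing R₁] [IsDiscreteValuationRing R₂]
    [IsAdicComplete (maximalIdeal R₁) R₁] [IsAdicComplete (maximalIdeal R₂) R₂]
    [CharZero R₁] [CharZero R₂]
    [CharP (ResidueField R₁) p] [CharP (ResidueField R₂) p]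
    [PerfectRing (ResidueField R₁) p] [PerfectRing (ResidueField R₂) p]
    (hspan₁ : Ideal.span {(p : R₁)} = maximalIdeal R₁ ^ e)
    (hspan₂ : Ideal.span {(p : R₂)} = maximalIdeal R₂ ^ e)
    (h : Nonempty ((R₁ ⧸ maximalIdeal R₁ ^ (e + 1)) ≃+* (R₂ ⧸ maximalIdeal R₂ ^ (e + 1)))) :
    Nonempty (R₁ ≃+* R₂) := by
  obtain ⟨φ⟩ := h
  obtain ⟨ψ, hψ⟩ := residue_equiv e R₁ R₂ φ
  obtain ⟨θ₁, hθ₁⟩ := exists_theta p e he R₁ hspan₁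
  obtain ⟨θ₂', hθ₂'⟩ := exists_theta p e he R₂ hspan₂
  let θ₂ : WittVector p (ResidueField R₁) →+* R₂ :=
    θ₂'.comp (WittVector.map (ψ : ResidueField R₁ →+* ResidueField R₂))
  have hθ₂ : ∀ x, residue R₂ (θ₂ x) = ψ (x.coeff 0) := fun x => by
    simp only [θ₂, RingHom.comp_apply, hθ₂', WittVector.map_coeff]; rfl
  -- properties
  have hs₁ : ∀ r, ∃ a, r - θ₁ a ∈ maximalIdeal R₁ := fun r =>
    ⟨WittVector.teichmuller p (residue R₁ r), by
      rw [← residue_eq_zero_iff, map_sub, hθ₁, WittVector.teichmuller_coeff_zero, sub_self]⟩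
  have hs₂ : ∀ r, ∃ a, r - θ₂ a ∈ maximalIdeal R₂ := fun r =>
    ⟨WittVector.teichmuller p (ψ.symm (residue R₂ r)), by
      rw [← residue_eq_zero_iff, map_sub, hθ₂, WittVector.teichmuller_coeff_zero,
        ψ.apply_symm_apply, sub_self]⟩
  have hi₁ : ∀ a, θ₁ a ∈ maximalIdeal R₁ → a.coeff 0 = 0 := fun a ha => by
    rwa [← residue_eq_zero_iff, hθ₁] at ha
  have hi₂ : ∀ a, θ₂ a ∈ maximalIdeal R₂ → a.coeff 0 = 0 := fun a ha => by
    rwa [← residue_eq_zero_iff, hθ₂, map_eq_zero] at ha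
  -- uniformizers
  obtain ⟨ϖ₁, hϖ₁⟩ := IsDiscreteValuationRing.exists_irreducible R₁
  obtain ⟨ϖ₂, hϖ₂⟩ := IsDiscreteValuationRing.exists_irreducible R₂
  have hm₁ := hϖ₁.maximalIdeal_eq
  have hm₂ := hϖ₂.maximalIdeal_eq
  obtain ⟨ρ, hρ⟩ := Ideal.Quotient.mk_surjective (φ (Ideal.Quotient.mk _ ϖ₁))
  have hmem : ∀ x y, φ (Ideal.Quotient.mk _ x) = Ideal.Quotient.mk _ y →
      (x ∈ maximalIdeal R₁ ↔ y ∈ maximalIdeal R₂) := fun x y hxy => by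
    rw [← residue_eq_zero_iff, ← residue_eq_zero_iff, ← hψ x y hxy,
      map_eq_zero_iff ψ ψ.injective]
  have hρm : ρ ∈ maximalIdeal R₂ := (hmem _ _ hρ.symm).mp
    (hm₁ ▸ Ideal.mem_span_singleton_self _)
  have hρspan : maximalIdeal R₂ = Ideal.span {ρ} := by
    apply le_antisymm
    · obtain ⟨x, hx⟩ := Ideal.Quotient.mk_surjective (φ.symm (Ideal.Quotient.mk _ ϖ₂))
      have hx' : φ (Ideal.Quotient.mk _ x) = Ideal.Quotient.mk _ ϖ₂ := by
        rw [hx, φ.apply_symm_apply]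
      have hxm := (hmem _ _ hx').mpr (hm₂ ▸ Ideal.mem_span_singleton_self _)
      rw [hm₁, Ideal.mem_span_singleton] at hxm
      obtain ⟨z, rfl⟩ := hxm
      obtain ⟨z', hz'⟩ := Ideal.Quotient.mk_surjective (φ (Ideal.Quotient.mk _ z))
      rw [map_mul, map_mul, ← hρ, ← hz', ← map_mul, Ideal.Quotient.eq] at hx'
      have h2 : ρ * z' - ϖ₂ ∈ maximalIdeal R₂ ^ 2 := Ideal.pow_le_pow_right (by omega) hx'
      rw [hm₂, Ideal.span_singleton_pow, Ideal.mem_span_singleton] at h2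
      obtain ⟨w, hw⟩ := h2
      have hu : IsUnit (1 + ϖ₂ * w) := by
        by_contra hn
        have hn' : 1 + ϖ₂ * w ∈ maximalIdeal R₂ := hn
        have h3 : ϖ₂ * w ∈ maximalIdeal R₂ := by
          rw [hm₂]; exact Ideal.mul_mem_right _ _ (Ideal.mem_span_singleton_self _)
        have h4 := Ideal.sub_mem _ hn' h3
        rw [add_sub_cancel_right] at h4
        exact h4 isUnit_one
      rw [hm₂, Ideal.span_singleton_le_iff_mem, Ideal.mem_span_singleton]
      have h5 : ρ ∣ ϖ₂ * (1 + ϖ₂ * w) := ⟨z', by linear_combination -hw⟩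
      exact hu.dvd_mul_right.mp h5
    · rwa [Ideal.span_singleton_le_iff_mem]
  have hρ0 : ρ ≠ 0 := by
    rintro rfl
    exact IsDiscreteValuationRing.not_a_field R₂ (by rw [hρspan]; simp)
  -- choice of the unit
  have hdvd : (p : R₁) ∣ ϖ₁ ^ e := by
    rw [← Ideal.mem_span_singleton, hspan₁]
    exact Ideal.pow_mem_pow (hm₁ ▸ Ideal.mem_span_singleton_self _) _
  obtain ⟨v, hv⟩ := hdvd
  obtain ⟨b, hb⟩ := hs₁ v
  have hp₁ : (p : R₁) ∈ maximalIdeal R₁ ^ e := hspan₁ ▸ Ideal.mem_span_singleton_self _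
  have hp₂ : (p : R₂) ∈ maximalIdeal R₂ ^ e := hspan₂ ▸ Ideal.mem_span_singleton_self _
  have hc₁ : ϖ₁ ^ e - θ₁ b * p ∈ maximalIdeal R₁ ^ (e + 1) := by
    have : ϖ₁ ^ e - θ₁ b * p = p * (v - θ₁ b) := by rw [hv]; ring
    rw [this, pow_succ]
    exact Ideal.mul_mem_mul hp₁ hb
  have hc₂ : ρ ^ e - θ₂ b * p ∈ maximalIdeal R₂ ^ (e + 1) := by
    obtain ⟨c, hc⟩ := Ideal.Quotient.mk_surjective (φ (Ideal.Quotient.mk _ (θ₁ b)))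
    have h1 : ρ ^ e - c * p ∈ maximalIdeal R₂ ^ (e + 1) := by
      rw [← Ideal.Quotient.eq_zero_iff_mem] at hc₁ ⊢
      have := congrArg φ hc₁
      simpa only [map_sub, map_mul, map_pow, map_natCast, ← hρ, ← hc, map_zero] using this
    have h2 : c - θ₂ b ∈ maximalIdeal R₂ := by
      rw [← residue_eq_zero_iff, map_sub, hθ₂, ← hψ _ _ hc.symm, hθ₁, sub_self]
    have h3 : ρ ^ e - θ₂ b * p = (ρ ^ e - c * p) + p * (c - θ₂ b) := by ring
    rw [h3]
    refine Ideal.add_mem _ h1 ?_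
    rw [pow_succ]
    exact Ideal.mul_mem_mul hp₂ h2
  obtain ⟨π₁, hπ₁, hb₁⟩ := adjust p e he hpe ϖ₁ (θ₁ b) hϖ₁.ne_zero hm₁ hspan₁ hc₁
  obtain ⟨π₂, hπ₂, hb₂⟩ := adjust p e he hpe ρ (θ₂ b) hρ0 hρspan hspan₂ hc₂
  have hπ₁0 : π₁ ≠ 0 := by
    rintro rfl
    exact IsDiscreteValuationRing.not_a_field R₁ (by rw [hπ₁]; simp)
  have hπ₂0 : π₂ ≠ 0 := by
    rintro rfl
    exact IsDiscreteValuationRing.not_a_field R₂ (by rw [hπ₂]; simp)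
  let Ψ₁ := Polynomial.eval₂RingHom θ₁ π₁
  let Ψ₂ := Polynomial.eval₂RingHom θ₂ π₂
  have hsur₁ : Function.Surjective Ψ₁ := surj he θ₁ hspan₁ hs₁ π₁ b hπ₁ hb₁
  have hsur₂ : Function.Surjective Ψ₂ := surj he θ₂ hspan₂ hs₂ π₂ b hπ₂ hb₂
  have hker : RingHom.ker Ψ₁ = RingHom.ker Ψ₂ := by
    ext f
    rw [RingHom.mem_ker, RingHom.mem_ker]
    exact (ker_iff he θ₁ hspan₁ hi₁ π₁ hπ₁0 hπ₁ b hb₁ f).trans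
      (ker_iff he θ₂ hspan₂ hi₂ π₂ hπ₂0 hπ₂ b hb₂ f).symm
  exact ⟨(RingHom.quotientKerEquivOfSurjective hsur₁).symm.trans
    ((Ideal.quotEquivOfEq hker).trans (RingHom.quotientKerEquivOfSurjective hsur₂))⟩
end

section
/- For every prime p and every integer e ≥ 2, there exist complete discrete valuation rings R₁ and R₂ of mixed characteristic (0,p) with perfect residue fields, with maximal ideals 𝔪₁, 𝔪₂ satisfying Ideal.span {(p : Rᵢ)} = 𝔪ᵢ^e for i = 1, 2, such that there is a ring isomorphism R₁/𝔪₁^e ≃ R₂/𝔪₂^e but there is no ring isomorphism R₁ ≃ R₂. -/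
open IsLocalRing
namespace EisTower
open Polynomial

variable (p : ℕ) [hp : Fact p.Prime] (k : Type) [Field k] [CharP k p] [PerfectRing k p]

/-- The Eisenstein type polynomial `X ^ e - p * g`. -/
noncomputable def poly (e : ℕ) (g : (WittVector p k)[X]) : (WittVector p k)[X] :=
  X ^ e - C (p : WittVector p k) * g

/-- The ring `W(k)[X] / (X ^ e - p * g)`. -/
abbrev Ring (e : ℕ) (g : (WittVector p k)[X]) : Type := AdjoinRoot (poly p k e g)

variable {p k} {e : ℕ} {g : (WittVector p k)[X]}

lemma degree_lt (hd : g.natDegree < e) : (C (p : WittVector p k) * g).degree < (e : WithBot ℕ) := by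
  refine lt_of_le_of_lt degree_le_natDegree ?_
  exact_mod_cast lt_of_le_of_lt (natDegree_C_mul_le _ _) hd

lemma monic (hd : g.natDegree < e) : (poly p k e g).Monic :=
  monic_X_pow_sub (degree_lt hd)

lemma natDegree_poly (hd : g.natDegree < e) : (poly p k e g).natDegree = e := by
  apply natDegree_eq_of_degree_eq_some
  have := degree_X_pow (R := WittVector p k) e
  rw [poly, degree_sub_eq_left_of_degree_lt, this]
  rw [this]; exact degree_lt hd

lemma irred (hd : g.natDegree < e) (hg : IsUnit (g.coeff 0)) : Irreducible (poly p k e g) := by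
  have hirr := WittVector.irreducible p (k := k)
  have hprime : (Ideal.span {(p : WittVector p k)}).IsPrime :=
    (Ideal.span_singleton_prime hirr.ne_zero).2 hirr.prime
  refine irreducible_of_eisenstein_criterion hprime ?_ ?_ ?_ ?_ (monic hd).isPrimitive
  · rw [(monic hd).leadingCoeff]
    exact fun h => hprime.ne_top ((Ideal.eq_top_iff_one _).2 h)
  · intro n hn
    rw [degree_eq_natDegree (monic hd).ne_zero, natDegree_poly hd] at hn
    have hn' : n < e := by exact_mod_cast hn
    rw [poly, coeff_sub, coeff_X_pow, if_neg hn'.ne, coeff_C_mul, zero_sub]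
    exact neg_mem (Ideal.mul_mem_right _ _ (Ideal.mem_span_singleton_self _))
  · rw [degree_eq_natDegree (monic hd).ne_zero, natDegree_poly hd]
    exact_mod_cast (by omega : 0 < e)
  · rw [poly, coeff_sub, coeff_X_pow, if_neg (by omega), coeff_C_mul, zero_sub, neg_mem_iff,
      Ideal.span_singleton_pow, Ideal.mem_span_singleton, hg.dvd_mul_right, sq]
    intro h
    have := (mul_dvd_mul_iff_left hirr.ne_zero).1 (by simpa using h : (p : WittVector p k) * p ∣ p * 1)
    exact hirr.not_isUnit (isUnit_of_dvd_one this)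

lemma isDomain (hd : g.natDegree < e) (hg : IsUnit (g.coeff 0)) : IsDomain (Ring p k e g) :=
  AdjoinRoot.isDomain_of_prime (irred hd hg).prime

/-- The class of `X`. -/
noncomputable abbrev rt (p k) [Fact p.Prime] [Field k] (e : ℕ) (g : (WittVector p k)[X]) : Ring p k e g :=
  AdjoinRoot.root (poly p k e g)

lemma rt_pow : rt p k e g ^ e = (p : Ring p k e g) * AdjoinRoot.mk _ g := by
  have h : AdjoinRoot.mk (poly p k e g) (poly p k e g) = 0 := AdjoinRoot.mk_self
  conv at h => lhs; arg 2; rw [poly]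
  rw [map_sub, map_pow, AdjoinRoot.mk_X, map_mul, AdjoinRoot.mk_C, map_natCast, sub_eq_zero] at h
  exact h

/-- The residue map. -/
noncomputable def res (hd : g.natDegree < e) : Ring p k e g →+* k :=
  AdjoinRoot.lift (WittVector.constantCoeff) 0 (by
    rw [poly, eval₂_sub, eval₂_mul, eval₂_C, eval₂_X_pow, map_natCast, CharP.cast_eq_zero,
      zero_pow (by omega)]
    simp)

lemma res_rt (hd : g.natDegree < e) : res hd (rt p k e g) = 0 := by
  simp [res, rt]

lemma res_of (hd : g.natDegree < e) (w : WittVector p k) :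
    res hd (AdjoinRoot.of _ w) = w.coeff 0 := by
  simp [res]

lemma res_surj (hd : g.natDegree < e) : Function.Surjective (res hd) := by
  intro a
  exact ⟨AdjoinRoot.of _ (WittVector.teichmuller p a), by rw [res_of]; simp⟩

lemma mk_eq (q : (WittVector p k)[X]) : ∃ r : Ring p k e g,
    AdjoinRoot.mk (poly p k e g) q = AdjoinRoot.of _ (q.coeff 0) + rt p k e g * r := by
  refine ⟨AdjoinRoot.mk _ q.divX, ?_⟩
  conv_lhs => rw [← divX_mul_X_add q]
  rw [map_add, map_mul, AdjoinRoot.mk_X, AdjoinRoot.mk_C]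
  ring

lemma p_mem (hd : g.natDegree < e) (hg : IsUnit (g.coeff 0)) : rt p k e g ∣ (p : Ring p k e g) := by
  obtain ⟨r, hr⟩ := mk_eq (e := e) (g := g) g
  have h := rt_pow (e := e) (g := g)
  rw [hr, mul_add] at h
  have hu : IsUnit (AdjoinRoot.of (poly p k e g) (g.coeff 0)) := hg.map _
  rw [← hu.dvd_mul_right, eq_sub_of_add_eq h.symm]
  exact dvd_sub (dvd_pow_self _ (by omega)) ((dvd_mul_right _ _).mul_left _)

lemma ker_res (hd : g.natDegree < e) (hg : IsUnit (g.coeff 0)) :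
    RingHom.ker (res hd) = Ideal.span {rt p k e g} := by
  apply le_antisymm
  · intro a ha
    obtain ⟨q, rfl⟩ := AdjoinRoot.mk_surjective a
    obtain ⟨r, hr⟩ := mk_eq (e := e) (g := g) q
    rw [RingHom.mem_ker, hr, map_add, map_mul, res_rt, res_of, zero_mul, add_zero,
      ← WittVector.mem_span_p_iff_coeff_zero_eq_zero, Ideal.mem_span_singleton] at ha
    rw [hr, Ideal.mem_span_singleton]
    refine dvd_add ((p_mem hd hg).trans ?_) (dvd_mul_right _ _)
    simpa using (map_dvd (AdjoinRoot.of (poly p k e g)) ha)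
  · rw [Ideal.span_singleton_le_iff_mem, RingHom.mem_ker, res_rt]

lemma isMax (hd : g.natDegree < e) (hg : IsUnit (g.coeff 0)) :
    (Ideal.span {rt p k e g}).IsMaximal := by
  rw [← ker_res hd hg]
  exact RingHom.ker_isMaximal_of_surjective _ (res_surj hd)

lemma isLocal (hd : g.natDegree < e) (hg : IsUnit (g.coeff 0)) : IsLocalRing (Ring p k e g) := by
  refine IsLocalRing.of_unique_max_ideal ⟨_, isMax hd hg, ?_⟩
  intro J hJ
  symm
  apply (isMax hd hg).eq_of_le hJ.ne_top
  rw [Ideal.span_singleton_le_iff_mem]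
  have hfin : Module.Finite (WittVector p k) (Ring p k e g) := (monic hd).finite_adjoinRoot
  have hint : Algebra.IsIntegral (WittVector p k) (Ring p k e g) := inferInstance
  have hm : (J.comap (algebraMap (WittVector p k) (Ring p k e g))).IsMaximal :=
    Ideal.isMaximal_comap_of_isIntegral_of_isMaximal J
  have hpm : (p : WittVector p k) ∈ J.comap (algebraMap (WittVector p k) (Ring p k e g)) := by
    rw [IsLocalRing.eq_maximalIdeal hm, IsLocalRing.mem_maximalIdeal]
    exact (WittVector.irreducible p (k := k)).not_isUnit
  rw [Ideal.mem_comap, map_natCast] at hpm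
  apply hJ.isPrime.mem_of_pow_mem e
  rw [rt_pow]
  exact J.mul_mem_right _ hpm

lemma max_eq (hd : g.natDegree < e) (hg : IsUnit (g.coeff 0)) [IsLocalRing (Ring p k e g)] :
    maximalIdeal (Ring p k e g) = Ideal.span {rt p k e g} :=
  (IsLocalRing.eq_maximalIdeal (isMax hd hg)).symm

lemma span_p (hd : g.natDegree < e) (hg : IsUnit (g.coeff 0)) [IsLocalRing (Ring p k e g)] :
    Ideal.span {(p : Ring p k e g)} = maximalIdeal (Ring p k e g) ^ e := by
  rw [max_eq hd hg, Ideal.span_singleton_pow, rt_pow]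
  have : IsUnit (AdjoinRoot.mk (poly p k e g) g) := by
    by_contra h
    rw [← mem_nonunits_iff, ← IsLocalRing.mem_maximalIdeal, max_eq hd hg, ← ker_res hd hg,
      RingHom.mem_ker] at h
    obtain ⟨r, hr⟩ := mk_eq (e := e) (g := g) g
    rw [hr, map_add, map_mul, res_rt, zero_mul, add_zero] at h
    have := (hg.map (AdjoinRoot.of (poly p k e g))).map (res hd)
    exact this.ne_zero h
  rw [Ideal.span_singleton_mul_right_unit this]

lemma charZero_W (p : ℕ) [hp : Fact p.Prime] (k : Type) [Field k] [CharP k p] [PerfectRing k p] :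
    CharZero (WittVector p k) := by
  obtain ⟨q, hq⟩ := CharP.exists (WittVector p k)
  have h0 : (q : k) = 0 := by
    rw [← map_natCast (WittVector.constantCoeff : WittVector p k →+* k) q, CharP.cast_eq_zero,
      map_zero]
  rw [CharP.cast_eq_zero_iff k p] at h0
  rcases CharP.char_is_prime_or_zero (WittVector p k) q with h | h
  · have := (Nat.prime_dvd_prime_iff_eq hp.out h).1 h0
    subst this
    exact absurd (CharP.cast_eq_zero (WittVector p k) p)
      (WittVector.irreducible p (k := k)).ne_zero
  · subst h
    exact CharP.charP_to_charZero _

lemma charZero (hd : g.natDegree < e) : CharZero (Ring p k e g) := by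
  have h1 : Function.Injective (AdjoinRoot.of (poly p k e g)) :=
    AdjoinRoot.of.injective_of_degree_ne_zero (by
      rw [degree_eq_natDegree (monic hd).ne_zero, natDegree_poly hd]
      exact_mod_cast (by omega : e ≠ 0))
  have := charZero_W p k
  exact charZero_of_injective_ringHom h1

lemma p_ne (hd : g.natDegree < e) : (p : Ring p k e g) ≠ 0 := by
  have := charZero (p := p) (k := k) hd
  exact_mod_cast hp.out.ne_zero

lemma isDVR (hd : g.natDegree < e) (hg : IsUnit (g.coeff 0)) [IsDomain (Ring p k e g)]
    [IsLocalRing (Ring p k e g)] : IsDiscreteValuationRing (Ring p k e g) := by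
  have hfin : Module.Finite (WittVector p k) (Ring p k e g) := (monic hd).finite_adjoinRoot
  have : IsNoetherianRing (Ring p k e g) := IsNoetherianRing.of_finite (WittVector p k) _
  have hnf : ¬ IsField (Ring p k e g) := by
    rw [IsLocalRing.isField_iff_maximalIdeal_eq, max_eq hd hg, Ideal.span_singleton_eq_bot]
    intro h
    have := p_mem hd hg
    rw [h, zero_dvd_iff] at this
    exact p_ne hd this
  refine ((IsDiscreteValuationRing.TFAE _ hnf).out 0 4).2 ?_
  exact ⟨⟨_, max_eq hd hg⟩⟩


lemma adicComplete (hd : g.natDegree < e) (hg : IsUnit (g.coeff 0)) [IsDomain (Ring p k e g)]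
    [IsLocalRing (Ring p k e g)] :
    IsAdicComplete (maximalIdeal (Ring p k e g)) (Ring p k e g) := by
  have hfin : Module.Finite (WittVector p k) (Ring p k e g) := (monic hd).finite_adjoinRoot
  have : IsNoetherianRing (Ring p k e g) := IsNoetherianRing.of_finite (WittVector p k) _
  have hH : IsHausdorff (maximalIdeal (Ring p k e g)) (Ring p k e g) := inferInstance
  have hpow : ∀ n a, a ∈ maximalIdeal (Ring p k e g) ^ (e * n) ↔ (p : Ring p k e g) ^ n ∣ a := by
    intro n a
    rw [pow_mul, ← span_p hd hg, Ideal.span_singleton_pow, Ideal.mem_span_singleton]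
  refine { hH with prec' := ?_ }
  intro f hf
  simp only [smul_eq_mul, Ideal.mul_top, SModEq.sub_mem] at hf ⊢
  have hf' : ∀ m n, m ≤ n → f m - f n ∈ maximalIdeal (Ring p k e g) ^ m := fun m n h => hf h
  set b := (AdjoinRoot.powerBasis' (monic (p := p) (k := k) hd)).basis with hb
  have hc : ∀ i, ∃ L : WittVector p k, ∀ n,
      (p : WittVector p k) ^ n ∣ b.repr (f (e * n)) i - L := by
    intro i
    have hW := (inferInstance : IsAdicComplete (Ideal.span {(p : WittVector p k)})
      (WittVector p k)).toIsPrecomplete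
    obtain ⟨L, hL⟩ := hW.prec (f := fun n => b.repr (f (e * n)) i) (by
      intro m n hmn
      simp only [smul_eq_mul, Ideal.mul_top, SModEq.sub_mem, Ideal.span_singleton_pow,
        Ideal.mem_span_singleton]
      obtain ⟨c, hc⟩ := (hpow m _).1 (hf' (e * m) (e * n) (Nat.mul_le_mul_left e hmn))
      have h2 : f (e * m) - f (e * n) = (p : WittVector p k) ^ m • c := by
        rw [hc, Algebra.smul_def, map_pow, map_natCast]
      have h3 := congrArg (fun z => b.repr z i) h2
      simp only [map_sub, map_smul, Finsupp.sub_apply, Finsupp.smul_apply, smul_eq_mul] at h3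
      exact ⟨_, h3⟩)
    refine ⟨L, fun n => ?_⟩
    have := hL n
    simpa only [smul_eq_mul, Ideal.mul_top, SModEq.sub_mem, Ideal.span_singleton_pow,
        Ideal.mem_span_singleton] using this
  choose L hL using hc
  refine ⟨∑ i, L i • b i, fun n => ?_⟩
  have h1 : f n - f (e * n) ∈ maximalIdeal (Ring p k e g) ^ n :=
    hf' _ _ (Nat.le_mul_of_pos_left n (by omega))
  have h2 : f (e * n) - ∑ i, L i • b i ∈ maximalIdeal (Ring p k e g) ^ (e * n) := by
    rw [hpow]
    conv_rhs => rw [← b.sum_repr (f (e * n))]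
    rw [← Finset.sum_sub_distrib]
    refine Finset.dvd_sum fun i _ => ?_
    rw [← sub_smul, Algebra.smul_def]
    refine Dvd.dvd.mul_right ?_ _
    simpa using map_dvd (algebraMap (WittVector p k) (Ring p k e g)) (hL i n)
  have h3 := Ideal.pow_le_pow_right (Nat.le_mul_of_pos_left n (by omega : 0 < e)) h2
  simpa using add_mem h1 h3

/-- The residue field. -/
noncomputable def resEquiv (hd : g.natDegree < e) (hg : IsUnit (g.coeff 0))
    [IsLocalRing (Ring p k e g)] : ResidueField (Ring p k e g) ≃+* k :=
  (Ideal.quotEquivOfEq ((max_eq hd hg).trans (ker_res hd hg).symm)).trans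
    (RingHom.quotientKerEquivOfSurjective (res_surj hd))

/-- The `e`-th residue ring. -/
noncomputable def quotEquiv (hd : g.natDegree < e) (hg : IsUnit (g.coeff 0))
    [IsLocalRing (Ring p k e g)] :
    (Ring p k e g ⧸ maximalIdeal (Ring p k e g) ^ e) ≃+*
      ((WittVector p k ⧸ Ideal.span {(p : WittVector p k)})[X] ⧸
        Ideal.span {(X : (WittVector p k ⧸ Ideal.span {(p : WittVector p k)})[X]) ^ e}) :=
  ((Ideal.quotEquivOfEq (by
      rw [← span_p hd hg, Ideal.map_span, Set.image_singleton, map_natCast])).trans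
    (AdjoinRoot.quotAdjoinRootEquivQuotPolynomialQuot
      (Ideal.span {(p : WittVector p k)}) (poly p k e g))).trans
    (Ideal.quotEquivOfEq (by
      congr 2
      have : Ideal.Quotient.mk (Ideal.span {(p : WittVector p k)}) (p : WittVector p k) = 0 :=
        Ideal.Quotient.eq_zero_iff_mem.2 (Ideal.mem_span_singleton_self _)
      rw [poly, Polynomial.map_sub, Polynomial.map_mul, map_C, this, map_zero, zero_mul, sub_zero,
        Polynomial.map_pow, map_X]))

/-- An isomorphism from the ring of `X ^ e - p` gives an `e`-th root of `g⁻¹`. -/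
lemma exists_root (hd : g.natDegree < e) (hg : IsUnit (g.coeff 0))
    (φ : Ring p k e 1 ≃+* Ring p k e g) :
    ∃ c : Ring p k e g, c ^ e * AdjoinRoot.mk _ g = 1 := by
  have := isDomain hd hg
  have hne : rt p k e g ≠ 0 := by
    intro h
    have := p_mem hd hg
    rw [h, zero_dvd_iff] at this
    exact p_ne hd this
  have hpr : Prime (rt p k e g) := by
    rw [← Ideal.span_singleton_prime hne]
    exact (isMax hd hg).isPrime
  have hy : φ (rt p k e 1) ^ e = p := by
    rw [← map_pow, rt_pow, map_one, mul_one, map_natCast]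
  obtain ⟨c, hc⟩ : rt p k e g ∣ φ (rt p k e 1) := by
    apply hpr.dvd_of_dvd_pow (n := e)
    rw [hy]; exact p_mem hd hg
  refine ⟨c, ?_⟩
  have h := rt_pow (p := p) (k := k) (e := e) (g := g)
  rw [← hy, hc, mul_pow, mul_assoc] at h
  exact (mul_left_cancel₀ (pow_ne_zero e hne) ((mul_one _).trans h)).symm

lemma no_iso_tame {t : k} (ht : ∀ c : k, c ^ e * t ≠ 1)
    (hd : (C (WittVector.teichmuller p t)).natDegree < e)
    (hg : IsUnit ((C (WittVector.teichmuller p t)).coeff 0)) :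
    IsEmpty (Ring p k e 1 ≃+* Ring p k e (C (WittVector.teichmuller p t))) := by
  refine ⟨fun φ => ?_⟩
  obtain ⟨c, hc⟩ := exists_root hd hg φ
  apply ht (res hd c)
  have := congrArg (res hd) hc
  rwa [AdjoinRoot.mk_C, map_mul, map_pow, res_of, map_one,
    WittVector.teichmuller_coeff_zero] at this

lemma no_iso_wild (he : 2 ≤ e) (hpe : p ∣ e)
    (hd : (1 - X : (WittVector p k)[X]).natDegree < e)
    (hg : IsUnit ((1 - X : (WittVector p k)[X]).coeff 0)) :
    IsEmpty (Ring p k e 1 ≃+* Ring p k e (1 - X)) := by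
  refine ⟨fun φ => ?_⟩
  obtain ⟨c, hc⟩ := exists_root hd hg φ
  have := isDomain hd hg
  have := isLocal hd hg
  obtain ⟨m, rfl⟩ := hpe
  rw [pow_mul'] at hc
  generalize c ^ m = w at hc
  set x := rt p k (p * m) (1 - X) with hx
  rw [map_sub, map_one, AdjoinRoot.mk_X] at hc
  change w ^ p * (1 - x) = 1 at hc
  have hw : res hd (w - 1) = 0 := by
    have h := congrArg (res hd) hc
    rw [map_mul, map_sub, res_rt, map_one, sub_zero, mul_one, map_pow] at h
    have h2 : (res hd w - 1) ^ p = 0 := by rw [sub_pow_char, h, one_pow, sub_self]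
    rw [map_sub, map_one]
    exact pow_eq_zero_iff hp.out.ne_zero |>.1 h2
  rw [← RingHom.mem_ker, ker_res hd hg, Ideal.mem_span_singleton] at hw
  obtain ⟨z, hz⟩ := hw
  obtain rfl : w = 1 + x * z := by rw [← hz]; ring
  obtain ⟨r, hr⟩ := exists_add_pow_prime_eq hp.out (1 : Ring p k (p * m) (1 - X)) (x * z)
  have hpx : x ^ 2 ∣ (p : Ring p k (p * m) (1 - X)) := by
    have h := span_p hd hg
    rw [max_eq hd hg, Ideal.span_singleton_pow, Ideal.span_singleton_eq_span_singleton] at h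
    exact (pow_dvd_pow _ he).trans h.symm.dvd
  have h2 : x ^ 2 ∣ (1 + x * z) ^ p - 1 := by
    rw [hr]
    have h3 : x ^ 2 ∣ (x * z) ^ p :=
      ((pow_dvd_pow _ hp.out.two_le).trans (pow_dvd_pow_of_dvd (dvd_mul_right x z) p))
    have h4 : x ^ 2 ∣ p * 1 * (x * z) * r := by
      rw [mul_assoc, mul_assoc]; exact hpx.mul_right _
    have := dvd_add h3 h4
    convert this using 1
    rw [one_pow]; ring
  obtain ⟨s, hs⟩ := h2
  have h5 : (1 + x ^ 2 * s) * (1 - x) = 1 := by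
    rw [← hs, add_sub_cancel]; exact hc
  have hne : x ≠ 0 := by
    intro h
    have := p_mem hd hg
    rw [← hx, h, zero_dvd_iff] at this
    exact p_ne hd this
  have h6 : x * (x * (s * (1 - x))) = x * 1 := by linear_combination h5
  have h7 := mul_left_cancel₀ hne h6
  have h8 : IsUnit x := IsUnit.of_mul_eq_one _ h7
  have h9 := (isMax hd hg).ne_top
  exact h9 (Ideal.span_singleton_eq_top.2 h8)

lemma perfect_of_equiv {A B : Type} [CommRing A] [CommRing B] (φ : A ≃+* B) (q : ℕ)
    [h : PerfectRing B q] : PerfectRing A q := by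
  have hb := h.bijective_frobenius
  refine ⟨⟨fun a b hab => ?_, fun a => ?_⟩⟩
  · apply φ.injective
    apply hb.1
    have := congrArg φ hab
    simpa using this
  · obtain ⟨b, hb⟩ := hb.2 (φ a)
    refine ⟨φ.symm b, ?_⟩
    apply φ.injective
    simpa using hb

/-- Assembly. -/
lemma main (he : 2 ≤ e) (hd : g.natDegree < e) (hg : IsUnit (g.coeff 0))
    (hE : IsEmpty (Ring p k e 1 ≃+* Ring p k e g)) :
    ∃ (R₁ R₂ : Type) (_ : CommRing R₁) (_ : CommRing R₂) (_ : IsDomain R₁) (_ : IsDomain R₂)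
      (_ : IsLocalRing R₁) (_ : IsLocalRing R₂)
      (_ : IsDiscreteValuationRing R₁) (_ : IsDiscreteValuationRing R₂)
      (_ : IsAdicComplete (maximalIdeal R₁) R₁) (_ : IsAdicComplete (maximalIdeal R₂) R₂)
      (_ : CharZero R₁) (_ : CharZero R₂)
      (_ : CharP (ResidueField R₁) p) (_ : CharP (ResidueField R₂) p),
      PerfectRing (ResidueField R₁) p ∧ PerfectRing (ResidueField R₂) p ∧
      Ideal.span {(p : R₁)} = maximalIdeal R₁ ^ e ∧
      Ideal.span {(p : R₂)} = maximalIdeal R₂ ^ e ∧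
      Nonempty ((R₁ ⧸ maximalIdeal R₁ ^ e) ≃+* (R₂ ⧸ maximalIdeal R₂ ^ e)) ∧
      IsEmpty (R₁ ≃+* R₂) := by
  have hd1 : (1 : (WittVector p k)[X]).natDegree < e := by rw [natDegree_one]; omega
  have hg1 : IsUnit ((1 : (WittVector p k)[X]).coeff 0) := by simp
  have i1 := isDomain hd1 hg1
  have i2 := isDomain hd hg
  have l1 := isLocal hd1 hg1
  have l2 := isLocal hd hg
  have c1 : CharP (ResidueField (Ring p k e 1)) p :=
    charP_of_injective_ringHom (RingHom.injective (resEquiv hd1 hg1).symm.toRingHom) p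
  have c2 : CharP (ResidueField (Ring p k e g)) p :=
    charP_of_injective_ringHom (RingHom.injective (resEquiv hd hg).symm.toRingHom) p
  refine ⟨Ring p k e 1, Ring p k e g, inferInstance, inferInstance, i1, i2, l1, l2,
    isDVR hd1 hg1, isDVR hd hg, adicComplete hd1 hg1, adicComplete hd hg, charZero hd1,
    charZero hd, c1, c2, ?_, ?_, span_p hd1 hg1, span_p hd hg,
    ⟨(quotEquiv hd1 hg1).trans (quotEquiv hd hg).symm⟩, hE⟩
  · exact perfect_of_equiv (resEquiv hd1 hg1) p
  · exact perfect_of_equiv (resEquiv hd hg) p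

lemma exists_field (p : ℕ) [hp : Fact p.Prime] (he : 2 ≤ e) (hpe : ¬ p ∣ e) :
    ∃ (n : ℕ) (t : GaloisField p n), t ≠ 0 ∧ ∀ c : GaloisField p n, c ^ e * t ≠ 1 := by
  have hcop : Nat.Coprime p e := (Nat.Prime.coprime_iff_not_dvd hp.out).2 hpe
  have hn : e.totient ≠ 0 := (Nat.totient_pos.2 (by omega)).ne'
  refine ⟨e.totient, ?_⟩
  have hcard : Nat.card (GaloisField p e.totient)ˣ = p ^ e.totient - 1 := by
    rw [Nat.card_units, GaloisField.card p _ hn]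
  have hdvd : e ∣ Nat.card (GaloisField p e.totient)ˣ := by
    rw [hcard]
    exact (Nat.modEq_iff_dvd' (Nat.one_le_pow _ _ hp.out.pos)).1 (Nat.ModEq.pow_totient hcop).symm
  obtain ⟨u, hu⟩ := IsCyclic.exists_generator (α := (GaloisField p e.totient)ˣ)
  have ho := orderOf_eq_card_of_forall_mem_zpowers hu
  refine ⟨(u : GaloisField p e.totient), u.ne_zero, fun c hc => ?_⟩
  have hc0 : c ≠ 0 := by
    rintro rfl
    rw [zero_pow (by omega), zero_mul] at hc
    exact zero_ne_one hc
  obtain ⟨m, hm⟩ := hdvd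
  have hu' : (Units.mk0 c hc0) ^ e * u = 1 := by
    ext; simpa using hc
  have h1 : u ^ m = 1 := by
    have h2 : ((Units.mk0 c hc0) ^ e * u) ^ m = 1 := by rw [hu', one_pow]
    rwa [mul_pow, ← pow_mul, ← hm, pow_card_eq_one', one_mul] at h2
  have hpos : 0 < Nat.card (GaloisField p e.totient)ˣ := Nat.card_pos
  have hm0 : 0 < m := by
    rcases Nat.eq_zero_or_pos m with h | h
    · rw [hm, h] at hpos; omega
    · exact h
  have := Nat.le_of_dvd hm0 (orderOf_dvd_of_pow_eq_one h1)
  rw [ho, hm] at this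
  nlinarith

end EisTower

/-- For every prime `p` and every `e ≥ 2` there are two complete discrete valuation
rings of mixed characteristic `(0,p)` with perfect residue fields and absolute
ramification index `e` whose `e`-th residue rings are isomorphic but which are not
isomorphic. -/
theorem exists_nonisomorphic_with_iso_e_residue_rings (p : ℕ) [Fact p.Prime]
    (e : ℕ) (he : 2 ≤ e) :
    ∃ (R₁ R₂ : Type) (_ : CommRing R₁) (_ : CommRing R₂) (_ : IsDomain R₁) (_ : IsDomain R₂)
      (_ : IsLocalRing R₁) (_ : IsLocalRing R₂)
      (_ : IsDiscreteValuationRing R₁) (_ : IsDiscreteValuationRing R₂)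
      (_ : IsAdicComplete (maximalIdeal R₁) R₁) (_ : IsAdicComplete (maximalIdeal R₂) R₂)
      (_ : CharZero R₁) (_ : CharZero R₂)
      (_ : CharP (ResidueField R₁) p) (_ : CharP (ResidueField R₂) p),
      PerfectRing (ResidueField R₁) p ∧ PerfectRing (ResidueField R₂) p ∧
      Ideal.span {(p : R₁)} = maximalIdeal R₁ ^ e ∧
      Ideal.span {(p : R₂)} = maximalIdeal R₂ ^ e ∧
      Nonempty ((R₁ ⧸ maximalIdeal R₁ ^ e) ≃+* (R₂ ⧸ maximalIdeal R₂ ^ e)) ∧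
      IsEmpty (R₁ ≃+* R₂) := by
  by_cases hpe : p ∣ e
  · have hd : (1 - Polynomial.X : Polynomial (WittVector p (ZMod p))).natDegree < e := by
      refine lt_of_le_of_lt (Polynomial.natDegree_sub_le _ _) ?_
      rw [Polynomial.natDegree_one, Polynomial.natDegree_X]
      simpa using (by omega : 1 < e)
    have hg : IsUnit ((1 - Polynomial.X : Polynomial (WittVector p (ZMod p))).coeff 0) := by simp
    exact EisTower.main he hd hg (EisTower.no_iso_wild he hpe hd hg)
  · obtain ⟨n, t, ht0, ht⟩ := EisTower.exists_field p he hpe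
    have hd : (Polynomial.C (WittVector.teichmuller p t)).natDegree < e := by
      rw [Polynomial.natDegree_C]; omega
    have hg : IsUnit ((Polynomial.C (WittVector.teichmuller p t)).coeff 0) := by
      rw [Polynomial.coeff_C_zero]
      exact (isUnit_iff_ne_zero.2 ht0).map (WittVector.teichmuller p)
    exact EisTower.main he hd hg (EisTower.no_iso_tame ht hd hg)
end
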